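/- arXiv:1612.07786 — 6 statements merged into one kernel-verified Lean document; each statement's English description precedes it below -/
import Mathlib

section
/- Let K be a perfect field and let I := (F_1, ..., F_s) ⊆ K[X_1, ..., X_n] be an ideal such that the Krull dimension of K[X_1, ..., X_n]/I equals n − s. Let J be the ideal of K[X_1, ..., X_n] generated by I together with all (s × s)-minors of the Jacobian matrix (∂F_i/∂X_j)_{1≤i≤s, 1≤j≤n}. Then I is a radical ideal if and only if J is not contained in any minimal prime of I. -/
open RingTheory.Sequence IsLocalRing Module
open scoped Pointwise

section CohenMacaulay

universe u

variable {S : Type u} [CommRing S] [IsNoetherianRing S] [IsLocalRing S]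

open CategoryTheory Abelian Limits in
/-- Dividing by a regular element drops the depth by at most one. -/
theorem exists_isRegular_quotSMulTop {M : Type u} [AddCommGroup M] [Module S M] [Module.Finite S M]
    [Nontrivial M] {x : S} (hx : x ∈ maximalIdeal S) (hreg : IsSMulRegular M x) {d : ℕ}
    (h : ∃ rs : List S, rs.length = d + 1 ∧ (∀ r ∈ rs, r ∈ maximalIdeal S) ∧ IsRegular M rs) :
    ∃ rs : List S, rs.length = d ∧ (∀ r ∈ rs, r ∈ maximalIdeal S) ∧
      IsRegular (QuotSMulTop x M) rs := by
  have lt_of_nontrivial (N : Type u) [AddCommGroup N] [Module S N] [Module.Finite S N]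
      [Nontrivial N] : maximalIdeal S • (⊤ : Submodule S N) < ⊤ :=
    lt_top_iff_ne_top.mpr (Submodule.top_ne_ideal_smul_of_le_jacobson_annihilator
      (maximalIdeal_le_jacobson _)).symm
  have : Nontrivial (QuotSMulTop x M) := by
    refine Submodule.Quotient.nontrivial_iff.mpr ?_
    exact (Submodule.top_ne_pointwise_smul_of_mem_jacobson_annihilator
      (maximalIdeal_le_jacobson _ hx)).symm
  have hE := ((ModuleCat.exists_isRegular_tfae (maximalIdeal S) (d + 1) (ModuleCat.of S M)
    (lt_of_nontrivial M)).out 3 1).mp h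
  refine ((ModuleCat.exists_isRegular_tfae (maximalIdeal S) d
    (ModuleCat.of S (QuotSMulTop x M)) (lt_of_nontrivial _)).out 1 3).mp fun i hi ↦ ?_
  have zero1 := AddCommGrpCat.isZero_of_iff_subsingleton.mpr (hE i (by omega))
  have zero2 := AddCommGrpCat.isZero_of_iff_subsingleton.mpr (hE (i + 1) (by omega))
  exact AddCommGrpCat.subsingleton_of_isZero <| ShortComplex.Exact.isZero_of_both_zeros
    ((Ext.covariant_sequence_exact₃' _
      (IsSMulRegular.smulShortComplex_shortExact (M := ModuleCat.of S M) hreg)) i (i + 1) rfl)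
    (zero1.eq_zero_of_src _) (zero2.eq_zero_of_tgt _)

/-- An associated prime of `M` together with a regular element lies in an associated prime of the
quotient by that element. -/
theorem exists_mem_associatedPrimes_quotSMulTop {M : Type*} [AddCommGroup M] [Module S M]
    [Module.Finite S M] {x : S} (hx : x ∈ maximalIdeal S) (hreg : IsSMulRegular M x)
    {p : Ideal S} (hp : p ∈ associatedPrimes S M) :
    ∃ q ∈ associatedPrimes S (QuotSMulTop x M), p < q := by
  obtain ⟨hpp, y, hy⟩ := isAssociatedPrime_iff.mp hp
  have hxp : x ∉ p := fun h ↦ by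
    rw [hy, Submodule.mem_colon_singleton, Submodule.mem_bot] at h
    have hy0 : y = 0 := hreg (by simpa using h)
    exact hpp.ne_top (by simp [hy, hy0])
  let N : Submodule S M := Submodule.torsionBySet S M p
  have hyN : y ∈ N := by
    rw [Submodule.mem_torsionBySet_iff]
    rintro ⟨a, ha⟩
    rw [SetLike.mem_coe, hy, Submodule.mem_colon_singleton, Submodule.mem_bot] at ha
    exact ha
  have hN : ¬ N ≤ x • (⊤ : Submodule S M) := by
    intro hle
    have hNN : N ≤ maximalIdeal S • N := by
      intro z hz
      obtain ⟨w, -, rfl⟩ := Submodule.mem_smul_pointwise_iff_exists _ _ _ |>.mp (hle hz)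
      refine Submodule.smul_mem_smul hx ?_
      rw [Submodule.mem_torsionBySet_iff] at hz ⊢
      intro a
      apply hreg
      simpa [smul_comm x] using hz a
    have hbot := Submodule.eq_bot_of_le_smul_of_le_jacobson_bot (maximalIdeal S) N
      (IsNoetherian.noetherian N) hNN (maximalIdeal_le_jacobson _)
    have hy0 : y = 0 := by simpa [hbot] using hyN
    exact hpp.ne_top (by simp [hy, hy0])
  obtain ⟨z, hzN, hz⟩ := SetLike.not_le_iff_exists.mp hN
  obtain ⟨q, hq, hle⟩ := exists_le_isAssociatedPrime_of_isNoetherianRing S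
    (Submodule.Quotient.mk z : QuotSMulTop x M)
    (by rwa [Ne, Submodule.Quotient.mk_eq_zero])
  refine ⟨q, hq, lt_of_le_of_ne (fun a ha ↦ hle ?_) fun h ↦ hxp (h ▸ hle ?_)⟩
  · rw [Submodule.mem_colon_singleton, Submodule.mem_bot, ← Submodule.Quotient.mk_smul,
      (Submodule.mem_torsionBySet_iff _ _).mp hzN ⟨a, ha⟩, Submodule.Quotient.mk_zero]
  · rw [Submodule.mem_colon_singleton, Submodule.mem_bot, ← Submodule.Quotient.mk_smul,
      Submodule.Quotient.mk_eq_zero]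
    exact Submodule.smul_mem_pointwise_smul _ _ _ trivial

theorem ringKrullDim_quotient_succ_le_of_lt {R : Type*} [CommRing R] {p q : Ideal R}
    [hp : p.IsPrime] (h : p < q) :
    ringKrullDim (R ⧸ q) + 1 ≤ ringKrullDim (R ⧸ p) := by
  obtain ⟨x, hxq, hxp⟩ := SetLike.exists_of_lt h
  have hmem : Ideal.Quotient.mk p x ∈ nonZeroDivisors (R ⧸ p) :=
    mem_nonZeroDivisors_of_ne_zero (by rwa [Ne, Ideal.Quotient.eq_zero_iff_mem])
  refine ringKrullDim_succ_le_of_surjective (Ideal.Quotient.factor h.le)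
    (Ideal.Quotient.factor_surjective h.le) hmem ?_
  simpa [Ideal.Quotient.eq_zero_iff_mem] using hxq

/-- The depth is at most the dimension of every associated prime. -/
theorem length_le_ringKrullDim_of_mem_associatedPrimes {M : Type*} [AddCommGroup M] [Module S M]
    [Module.Finite S M] (rs : List S) (hmem : ∀ r ∈ rs, r ∈ maximalIdeal S)
    (hreg : IsRegular M rs) {p : Ideal S} (hp : p ∈ associatedPrimes S M) :
    (rs.length : WithBot ℕ∞) ≤ ringKrullDim (S ⧸ p) := by
  induction rs generalizing M p with
  | nil =>
    have := hp.1
    simpa using ringKrullDim_nonneg_of_nontrivial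
  | cons x rs ih =>
    have := hp.1
    rw [isRegular_cons_iff] at hreg
    obtain ⟨q, hq, hlt⟩ :=
      exists_mem_associatedPrimes_quotSMulTop (hmem x (by simp)) hreg.1 hp
    have h1 := ih (fun r hr ↦ hmem r (by simp [hr])) hreg.2 hq
    refine le_trans ?_ (ringKrullDim_quotient_succ_le_of_lt hlt)
    push_cast [List.length_cons]
    gcongr

theorem supportDim_le_supportDim_ofList_smul_add_length {M : Type*} [AddCommGroup M] [Module S M]
    [Module.Finite S M] (fs : List S) (hmem : ∀ r ∈ fs, r ∈ maximalIdeal S) :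
    supportDim S M ≤ supportDim S (M ⧸ Ideal.ofList fs • (⊤ : Submodule S M)) + fs.length := by
  induction fs generalizing M with
  | nil =>
    rw [Ideal.ofList_nil, Submodule.bot_smul]
    simpa using (supportDim_eq_of_equiv (Submodule.quotEquivOfEqBot ⊥ rfl)).ge
  | cons x fs ih =>
    rw [supportDim_eq_of_equiv (Submodule.quotOfListConsSMulTopEquivQuotSMulTopInner M x _)]
    refine (supportDim_le_supportDim_quotSMulTop_succ (hmem x (by simp))).trans ?_
    push_cast [List.length_cons]
    rw [← add_assoc]
    gcongr
    exact ih fun r hr ↦ hmem r (by simp [hr])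

theorem ringKrullDim_quotient_le_supportDim {R : Type*} [CommRing R] {M : Type*}
    [AddCommGroup M] [Module R M] [Module.Finite R M] {p : Ideal R} [hp : p.IsPrime]
    (h : (⟨p, hp⟩ : PrimeSpectrum R) ∈ Module.support R M) :
    ringKrullDim (R ⧸ p) ≤ supportDim R M := by
  rw [ringKrullDim_quotient, supportDim]
  refine Order.krullDim_le_of_strictMono
    (fun q ↦ ⟨q.1, Module.mem_support_mono (p := ⟨p, hp⟩) q.2 h⟩) fun a b hab ↦ hab

/-- **Unmixedness**: if `M` has depth at least `d + length fs` and `M / fs M` has dimension at most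
`d`, then all associated primes of `M / fs M` have dimension at least `d`. -/
theorem le_ringKrullDim_of_mem_associatedPrimes_ofList {M : Type u} [AddCommGroup M] [Module S M]
    [Module.Finite S M] [Nontrivial M] (d : ℕ) (fs : List S) (hfs : ∀ r ∈ fs, r ∈ maximalIdeal S)
    (h : ∃ rs : List S, rs.length = d + fs.length ∧ (∀ r ∈ rs, r ∈ maximalIdeal S) ∧
      IsRegular M rs)
    (hdim : supportDim S (M ⧸ Ideal.ofList fs • (⊤ : Submodule S M)) ≤ d)
    {p : Ideal S} (hp : p ∈ associatedPrimes S (M ⧸ Ideal.ofList fs • (⊤ : Submodule S M))) :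
    (d : WithBot ℕ∞) ≤ ringKrullDim (S ⧸ p) := by
  induction fs generalizing M with
  | nil =>
    obtain ⟨rs, hlen, hmem, hreg⟩ := h
    have e : (M ⧸ Ideal.ofList ([] : List S) • (⊤ : Submodule S M)) ≃ₗ[S] M :=
      Submodule.quotEquivOfEqBot _ (by simp)
    rw [LinearEquiv.AssociatedPrimes.eq e] at hp
    simpa [hlen] using length_le_ringKrullDim_of_mem_associatedPrimes rs hmem hreg hp
  | cons x fs ih =>
    have e := Submodule.quotOfListConsSMulTopEquivQuotSMulTopInner M x fs
    rw [LinearEquiv.AssociatedPrimes.eq e] at hp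
    rw [supportDim_eq_of_equiv e] at hdim
    have hx : x ∈ maximalIdeal S := hfs x (by simp)
    have hfs' : ∀ r ∈ fs, r ∈ maximalIdeal S := fun r hr ↦ hfs r (by simp [hr])
    have hreg : IsSMulRegular M x := by
      by_contra hnreg
      rw [isSMulRegular_iff_right_eq_zero_of_smul] at hnreg
      push Not at hnreg
      obtain ⟨m, hxm, hm⟩ := hnreg
      have hx' : x ∈ ⋃ p ∈ associatedPrimes S M, (p : Set S) := by
        rw [biUnion_associatedPrimes_eq_zero_divisors]
        exact ⟨m, hm, hxm⟩
      simp only [Set.mem_iUnion] at hx'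
      obtain ⟨q, hq, hxq⟩ := hx'
      obtain ⟨rs, hlen, hmem, hrs⟩ := h
      have h1 := length_le_ringKrullDim_of_mem_associatedPrimes rs hmem hrs hq
      have hq' : (⟨q, hq.1⟩ : PrimeSpectrum S) ∈ Module.support S (QuotSMulTop x M) := by
        rw [support_quotSMulTop]
        refine ⟨?_, by simpa using hxq⟩
        rw [Module.mem_support_iff_of_finite]
        simpa [Submodule.annihilator_top] using IsAssociatedPrime.annihilator_le hq
      have := hq.1
      have h2 := ringKrullDim_quotient_le_supportDim hq'
      have h3 := supportDim_le_supportDim_ofList_smul_add_length (M := QuotSMulTop x M) fs hfs'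
      have h4 : ((d + (fs.length + 1) : ℕ) : WithBot ℕ∞) ≤ ((d + fs.length : ℕ) : WithBot ℕ∞) := by
        rw [hlen] at h1
        refine (h1.trans (h2.trans h3)).trans ?_
        push_cast
        gcongr
      have h5 := WithBot.coe_le_coe.mp h4
      have := Nat.cast_le (α := ℕ∞).mp h5
      omega
    have : Nontrivial (QuotSMulTop x M) := by
      refine Submodule.Quotient.nontrivial_iff.mpr ?_
      exact (Submodule.top_ne_pointwise_smul_of_mem_jacobson_annihilator
        (maximalIdeal_le_jacobson _ hx)).symm
    exact ih hfs' (exists_isRegular_quotSMulTop hx hreg h) hdim hp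

end CohenMacaulay

section Polynomial

/-- Monic polynomials in distinct variables form a weakly regular sequence. -/
theorem exists_isWeaklyRegular_aeval_X {K : Type*} [CommRing K] (n : ℕ) (p : Fin n → Polynomial K)
    (hp : ∀ i, (p i).Monic) :
    ∃ rs : List (MvPolynomial (Fin n) K), rs.length = n ∧
      (∀ r ∈ rs, ∃ i, r = Polynomial.aeval (MvPolynomial.X i) (p i)) ∧
      IsWeaklyRegular (MvPolynomial (Fin n) K) rs := by
  induction n with
  | zero => exact ⟨[], rfl, by simp, .nil _ _⟩
  | succ n ih =>
    obtain ⟨rs, hlen, hmem, hreg⟩ := ih (fun i ↦ p i.succ) fun i ↦ hp _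
    let e := MvPolynomial.finSuccEquiv K n
    let g : Polynomial (MvPolynomial (Fin n) K) := (p 0).map (algebraMap K _)
    have hg : g.Monic := (hp 0).map _
    refine ⟨(rs.map Polynomial.C ++ [g]).map e.symm, by simp [hlen], ?_, ?_⟩
    · intro r hr
      simp only [List.map_append, List.map_map, List.map_cons, List.map_nil, List.mem_append,
        List.mem_map, Function.comp_apply, List.mem_singleton] at hr
      rcases hr with ⟨a, ha, rfl⟩ | rfl
      · obtain ⟨i, rfl⟩ := hmem a ha
        refine ⟨i.succ, ?_⟩
        rw [AlgEquiv.symm_apply_eq, ← Polynomial.aeval_algHom_apply e (MvPolynomial.X i.succ)]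
        rw [show e (MvPolynomial.X i.succ) = Polynomial.CAlgHom (R := K) (MvPolynomial.X i) from
          MvPolynomial.finSuccEquiv_X_succ, Polynomial.aeval_algHom_apply]
        rfl
      · refine ⟨0, ?_⟩
        rw [AlgEquiv.symm_apply_eq, ← Polynomial.aeval_algHom_apply,
          show e (MvPolynomial.X 0) = Polynomial.X from MvPolynomial.finSuccEquiv_X_zero,
          Polynomial.aeval_X_left_eq_map]
    · refine (AddEquiv.isWeaklyRegular_congr (e := e.symm.toAddEquiv)
        (as := rs.map Polynomial.C ++ [g]) (List.forall₂_map_right_iff.mpr <|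
          List.forall₂_same.mpr fun r _ x ↦ ?_)).mp ?_
      · simp
      · rw [isWeaklyRegular_append_iff, isWeaklyRegular_singleton_iff]
        refine ⟨hreg.of_flat (S := Polynomial (MvPolynomial (Fin n) K)), ?_⟩
        rw [isSMulRegular_iff_right_eq_zero_of_smul]
        intro x hx
        obtain ⟨y, rfl⟩ := Submodule.Quotient.mk_surjective _ x
        have hI : (Ideal.ofList (rs.map Polynomial.C) • ⊤ :
            Submodule (Polynomial (MvPolynomial (Fin n) K)) _) =
            RingHom.ker (Polynomial.mapRingHom (Ideal.Quotient.mk (Ideal.ofList rs))) := by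
          rw [Polynomial.ker_mapRingHom, Ideal.mk_ker, Ideal.map_ofList, smul_eq_mul,
            Ideal.mul_top]
        rw [← Submodule.Quotient.mk_smul, Submodule.Quotient.mk_eq_zero, hI] at hx
        rw [Submodule.Quotient.mk_eq_zero, hI]
        rw [RingHom.mem_ker, smul_eq_mul, map_mul, Polynomial.coe_mapRingHom,
          (hg.map _).mul_right_eq_zero_iff] at hx
        exact hx

/-- The localization of a polynomial ring at a maximal ideal has a regular sequence whose length is
the number of variables. -/
theorem exists_isRegular_localization_atPrime {K : Type*} [Field K] (n : ℕ)
    (m : Ideal (MvPolynomial (Fin n) K)) [hm : m.IsMaximal] :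
    ∃ rs : List (Localization.AtPrime m), rs.length = n ∧
      (∀ r ∈ rs, r ∈ maximalIdeal (Localization.AtPrime m)) ∧
      IsRegular (Localization.AtPrime m) rs := by
  let _ : Field (MvPolynomial (Fin n) K ⧸ m) := Ideal.Quotient.field m
  have : Module.Finite K (MvPolynomial (Fin n) K ⧸ m) :=
    finite_of_finite_type_of_isJacobsonRing K _
  have hintegral (i : Fin n) : IsIntegral K (Ideal.Quotient.mk m (MvPolynomial.X i)) :=
    Algebra.IsIntegral.isIntegral _
  obtain ⟨rs, hlen, hmem, hreg⟩ := exists_isWeaklyRegular_aeval_X n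
    (fun i ↦ minpoly K (Ideal.Quotient.mk m (MvPolynomial.X i))) fun i ↦ minpoly.monic (hintegral i)
  have hmax : ∀ r ∈ rs.map (algebraMap _ (Localization.AtPrime m)),
      r ∈ maximalIdeal (Localization.AtPrime m) := by
    intro r hr
    obtain ⟨a, ha, rfl⟩ := List.mem_map.mp hr
    obtain ⟨i, rfl⟩ := hmem a ha
    rw [IsLocalization.AtPrime.to_map_mem_maximal_iff _ m, ← Ideal.Quotient.eq_zero_iff_mem,
      ← Ideal.Quotient.mkₐ_eq_mk K, ← Polynomial.aeval_algHom_apply]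
    exact minpoly.aeval _ _
  refine ⟨_, by simpa using hlen, hmax, ?_⟩
  rw [IsLocalRing.isRegular_iff_isWeaklyRegular_of_subset_maximalIdeal hmax]
  exact hreg.of_isLocalization _ m.primeCompl

theorem ringKrullDim_quotient_map_le {R S : Type*} [CommRing R] [CommRing S] [Algebra R S]
    (T : Submonoid R) [IsLocalization T S] (I : Ideal R) :
    ringKrullDim (S ⧸ I.map (algebraMap R S)) ≤ ringKrullDim (R ⧸ I) := by
  rw [ringKrullDim_quotient, ringKrullDim_quotient]
  refine Order.krullDim_le_of_strictMono (fun q ↦ ⟨PrimeSpectrum.comap (algebraMap R S) q.1,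
    Ideal.map_le_iff_le_comap.mp q.2⟩) fun a b hab ↦ ?_
  refine lt_of_le_of_ne (Ideal.comap_mono hab.le) fun h ↦ hab.ne (Subtype.ext ?_)
  exact PrimeSpectrum.localization_comap_injective S T (congrArg Subtype.val h)

theorem map_mem_associatedPrimes_quotient_map {R S : Type*} [CommRing R] [IsNoetherianRing R]
    [CommRing S] [Algebra R S]
    (T : Submonoid R) [IsLocalization T S] {I Q : Ideal R} (hQ : Q ∈ associatedPrimes R (R ⧸ I))
    (hd : Disjoint (T : Set R) Q) :
    Q.map (algebraMap R S) ∈ associatedPrimes S (S ⧸ I.map (algebraMap R S)) := by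
  have : IsNoetherianRing S := IsLocalization.isNoetherianRing T S inferInstance
  obtain ⟨hQp, x, hx⟩ := isAssociatedPrime_iff.mp hQ
  obtain ⟨a, rfl⟩ := Ideal.Quotient.mk_surjective x
  have hmem (r : R) : r ∈ Q ↔ r * a ∈ I := by
    rw [hx, Submodule.mem_colon_singleton, Submodule.mem_bot, Algebra.smul_def,
      Ideal.Quotient.algebraMap_eq, ← map_mul, Ideal.Quotient.eq_zero_iff_mem]
  refine isAssociatedPrime_iff.mpr ⟨IsLocalization.isPrime_of_isPrime_disjoint T S Q hQp hd,
    Ideal.Quotient.mk _ (algebraMap R S a), ?_⟩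
  ext z
  obtain ⟨r, t, rfl⟩ := IsLocalization.exists_mk'_eq T z
  rw [Submodule.mem_colon_singleton, Submodule.mem_bot, Algebra.smul_def,
    Ideal.Quotient.algebraMap_eq, ← map_mul, Ideal.Quotient.eq_zero_iff_mem, mul_comm,
    IsLocalization.mul_mk'_eq_mk'_of_mul, IsLocalization.mk'_mem_map_algebraMap_iff,
    IsLocalization.mk'_mem_map_algebraMap_iff]
  refine exists_congr fun u ↦ and_congr_right fun _ ↦ ?_
  rw [hmem]
  ring_nf

/-- **Macaulay's unmixedness theorem** for polynomial rings over a field. -/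
theorem mem_minimalPrimes_of_mem_associatedPrimes {K : Type*} [Field K] {n s : ℕ} (hsn : s ≤ n)
    (F : Fin s → MvPolynomial (Fin n) K)
    (hdim : ringKrullDim (MvPolynomial (Fin n) K ⧸ Ideal.span (Set.range F)) ≤ (n - s : ℕ))
    {Q : Ideal (MvPolynomial (Fin n) K)}
    (hQ : Q ∈ associatedPrimes _ (MvPolynomial (Fin n) K ⧸ Ideal.span (Set.range F))) :
    Q ∈ (Ideal.span (Set.range F)).minimalPrimes := by
  set I := Ideal.span (Set.range F) with hI
  have hQp := hQ.1
  have hIQ : I ≤ Q := by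
    simpa [Submodule.annihilator_top, Ideal.annihilator_quotient] using
      IsAssociatedPrime.annihilator_le hQ
  obtain ⟨m, hm, hQm⟩ := Q.exists_le_maximal hQp.ne_top
  let S := Localization.AtPrime m
  have hdisj {P : Ideal (MvPolynomial (Fin n) K)} (h : P ≤ Q) :
      Disjoint (m.primeCompl : Set (MvPolynomial (Fin n) K)) P :=
    Set.disjoint_left.mpr fun a ha haP ↦ ha (hQm (h haP))
  let fs : List S := (List.ofFn F).map (algebraMap _ S)
  have hfs : Ideal.ofList fs = I.map (algebraMap _ S) := by
    rw [← Ideal.map_ofList]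
    congr 1
    simp [Ideal.ofList, hI, Set.range]
  have hfs' : (Ideal.ofList fs • ⊤ : Submodule S S) = I.map (algebraMap _ S) := by
    rw [hfs, smul_eq_mul, Ideal.mul_top]
  have hmem : ∀ r ∈ fs, r ∈ maximalIdeal S := by
    intro r hr
    obtain ⟨a, ha, rfl⟩ := List.mem_map.mp hr
    rw [List.mem_ofFn] at ha
    rw [IsLocalization.AtPrime.to_map_mem_maximal_iff _ m]
    exact hQm (hIQ (Ideal.subset_span ha))
  have hdimS := (ringKrullDim_quotient_map_le (S := S) m.primeCompl I).trans hdim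
  have hass := map_mem_associatedPrimes_quotient_map (S := S) m.primeCompl hQ (hdisj le_rfl)
  obtain ⟨rs, hlen, hrs⟩ := exists_isRegular_localization_atPrime n m
  have hle := le_ringKrullDim_of_mem_associatedPrimes_ofList (M := S) (n - s) fs hmem
    ⟨rs, by simp [fs, hlen, hsn], hrs⟩
    (by rw [supportDim_quotient_eq_ringKrullDim, hfs']; exact hdimS) (by rw [hfs']; exact hass)
  refine ⟨⟨hQp, hIQ⟩, fun P ⟨hP, hIP⟩ hPQ ↦ ?_⟩
  by_contra hQP
  have hPS := IsLocalization.isPrime_of_isPrime_disjoint m.primeCompl S P hP (hdisj hPQ)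
  have hlt : P.map (algebraMap _ S) < Q.map (algebraMap _ S) := by
    refine lt_of_le_of_ne (Ideal.map_mono hPQ) fun h ↦ hQP ?_
    have := congrArg (Ideal.under (MvPolynomial (Fin n) K)) h
    rw [IsLocalization.under_map_of_isPrime_disjoint m.primeCompl S hP (hdisj hPQ),
      IsLocalization.under_map_of_isPrime_disjoint m.primeCompl S hQp (hdisj le_rfl)] at this
    exact this.ge
  have h1 := ringKrullDim_quotient_succ_le_of_lt hlt
  have h2 : ringKrullDim (S ⧸ P.map (algebraMap _ S)) ≤
      ringKrullDim (S ⧸ I.map (algebraMap _ S)) :=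
    ringKrullDim_le_of_surjective (Ideal.Quotient.factor (Ideal.map_mono hIP))
      (Ideal.Quotient.factor_surjective _)
  have h3 : ((n - s + 1 : ℕ) : WithBot ℕ∞) ≤ ((n - s : ℕ) : WithBot ℕ∞) := by
    refine le_trans ?_ (h1.trans (h2.trans hdimS))
    push_cast
    gcongr
  have := Nat.cast_le (α := ℕ∞).mp (WithBot.coe_le_coe.mp h3)
  omega

end Polynomial

section Derivation

/-- Derivations extend to localizations. -/
theorem Derivation.exists_extension_of_isLocalization {K R S M : Type*} [CommRing K] [CommRing R]
    [CommRing S] [Algebra K R] [Algebra K S] [Algebra R S] [IsScalarTower K R S] (T : Submonoid R)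
    [IsLocalization T S] [AddCommGroup M] [Module K M] [Module R M] [Module S M]
    [IsScalarTower R S M] [IsScalarTower K S M] [IsScalarTower K R M] (D : Derivation K R M) :
    ∃ D' : Derivation K S M, ∀ r, D' (algebraMap R S r) = D r := by
  have : Algebra.FormallyEtale R S := .of_isLocalization T
  refine ⟨(D.liftKaehlerDifferential.liftBaseChange S ∘ₗ
    (KaehlerDifferential.tensorKaehlerEquivOfFormallyEtale K R S).symm.toLinearMap).compDer
      (KaehlerDifferential.D K S), fun r ↦ ?_⟩
  simp [KaehlerDifferential.tensorKaehlerEquivOfFormallyEtale_symm_D_algebraMap]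

/-- A derivation vanishing on the kernel of a surjection descends along it. -/
theorem Derivation.exists_lift_of_surjective {K A B M : Type*} [CommRing K] [CommRing A]
    [CommRing B] [Algebra K A] [Algebra K B] [Algebra A B] [IsScalarTower K A B] [AddCommGroup M]
    [Module K M] [Module A M] [Module B M] [IsScalarTower A B M] (D : Derivation K A M)
    (hf : Function.Surjective (algebraMap A B)) (hD : ∀ a, algebraMap A B a = 0 → D a = 0) :
    ∃ D' : Derivation K B M, ∀ a, D' (algebraMap A B a) = D a := by
  have hD' {a b : A} (h : algebraMap A B a = algebraMap A B b) : D a = D b := by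
    rw [← sub_eq_zero, ← map_sub]
    exact hD _ (by rw [map_sub, h, sub_self])
  let g := Function.surjInv hf
  have hg (b : B) : algebraMap A B (g b) = b := Function.surjInv_eq hf b
  have hsmul (b : B) (m : M) : g b • m = b • m := by rw [← algebraMap_smul B (g b) m, hg]
  let L : B →ₗ[K] M :=
    { toFun := fun b ↦ D (g b)
      map_add' := fun x y ↦ by
        rw [← map_add]
        exact hD' (by simp only [map_add, hg])
      map_smul' := fun k x ↦ by
        rw [RingHom.id_apply, ← map_smul]
        exact hD' (by simp only [Algebra.smul_def, map_mul, hg, ← IsScalarTower.algebraMap_apply]) }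
  refine ⟨.mk' L fun x y ↦ ?_, fun a ↦ hD' (hg _)⟩
  change D (g (x * y)) = x • D (g y) + y • D (g x)
  rw [← hsmul, ← hsmul, ← D.leibniz]
  exact hD' (by simp only [map_mul, hg])

theorem MvPolynomial.mkDerivation_eq_sum_pderiv {K σ A : Type*} [CommRing K] [Fintype σ]
    [CommRing A] [Algebra K A] [Algebra (MvPolynomial σ K) A]
    [IsScalarTower K (MvPolynomial σ K) A] (v : σ → A) (f : MvPolynomial σ K) :
    mkDerivation K v f = ∑ j, algebraMap _ A (pderiv j f) * v j := by
  classical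
  let D (j : σ) : Derivation K (MvPolynomial σ K) A :=
    (LinearMap.toSpanSingleton (MvPolynomial σ K) A (v j)).compDer (pderiv j)
  have hD (g : MvPolynomial σ K) : (∑ j, D j) g = ∑ j, D j g := by
    rw [← Finset.sum_apply]
    exact congrFun (map_sum Derivation.coeFnAddMonoidHom D Finset.univ) g
  have : mkDerivation K v = ∑ j, D j := by
    refine derivation_ext fun i ↦ ?_
    rw [mkDerivation_X, hD,
      Finset.sum_eq_single i (fun j _ hj ↦ by simp [D, pderiv_X_of_ne hj.symm]) (by simp)]
    simp [D]
  rw [this, hD]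
  simp [D, Algebra.smul_def]

/-- A derivation of a local ring into its residue field vanishes on the square of the maximal
ideal. -/
theorem Derivation.eq_zero_of_mem_maximalIdeal_sq {K S : Type*} [CommRing K] [CommRing S]
    [IsLocalRing S] [Algebra K S] (D : Derivation K S (ResidueField S)) {x : S}
    (hx : x ∈ maximalIdeal S ^ 2) : D x = 0 := by
  rw [pow_two] at hx
  induction hx using Submodule.mul_induction_on' with
  | mem_mul_mem a ha b hb =>
    have (c : S) (hc : c ∈ maximalIdeal S) (y : ResidueField S) : c • y = 0 := by
      rw [Algebra.smul_def, ResidueField.algebraMap_eq, (residue_eq_zero_iff c).mpr hc, zero_mul]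
    rw [D.leibniz, this a ha, this b hb, add_zero]
  | add a _ b _ ha hb => rw [map_add, ha, hb, add_zero]

end Derivation

section Jacobian

variable {K : Type*} [Field K] {n s : ℕ} (F : Fin s → MvPolynomial (Fin n) K)
  {P : Ideal (MvPolynomial (Fin n) K)}

/-- If some maximal minor of the Jacobian matrix does not vanish at a minimal prime `P` of
`(F₁, …, F_s)`, then `P` and `(F₁, …, F_s)` agree locally at `P`. -/
theorem exists_mul_mem_span_of_det_notMem (hP : P ∈ (Ideal.span (Set.range F)).minimalPrimes)
    (c : Fin s → Fin n)
    (hc : Matrix.det (Matrix.of fun i j : Fin s => MvPolynomial.pderiv (c j) (F i)) ∉ P)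
    {a : MvPolynomial (Fin n) K} (ha : a ∈ P) : ∃ t ∉ P, t * a ∈ Ideal.span (Set.range F) := by
  have hPp : P.IsPrime := hP.1.1
  let S := Localization.AtPrime P
  let ι := algebraMap (MvPolynomial (Fin n) K) S
  have hFm (i) : ι (F i) ∈ maximalIdeal S := by
    rw [IsLocalization.AtPrime.to_map_mem_maximal_iff _ P]
    exact hP.1.2 (Ideal.subset_span ⟨i, rfl⟩)
  let f (i : Fin s) : maximalIdeal S := ⟨ι (F i), hFm i⟩
  let v (i : Fin s) : CotangentSpace S := (maximalIdeal S).toCotangent (f i)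
  have hv : LinearIndependent (ResidueField S) v := by
    rw [Fintype.linearIndependent_iff]
    intro g hg
    choose b hb using fun i ↦ residue_surjective (g i)
    have hmem : ∑ i, b i * ι (F i) ∈ maximalIdeal S ^ 2 := by
      have : (maximalIdeal S).toCotangent (∑ i, b i • f i) = 0 := by
        rw [map_sum, ← hg]
        refine Finset.sum_congr rfl fun i _ ↦ ?_
        rw [map_smul, ← hb]
        rfl
      rw [Ideal.toCotangent_eq_zero] at this
      simpa [f] using this
    have hsum (j : Fin n) :
        ∑ i, g i * algebraMap _ P.ResidueField (MvPolynomial.pderiv j (F i)) = 0 := by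
      obtain ⟨D, hD⟩ := Derivation.exists_extension_of_isLocalization (S := S) P.primeCompl
        ((Algebra.linearMap (MvPolynomial (Fin n) K) P.ResidueField).compDer
          (MvPolynomial.pderiv (R := K) j))
      have h0 := D.eq_zero_of_mem_maximalIdeal_sq hmem
      rw [map_sum] at h0
      rw [← h0]
      refine Finset.sum_congr rfl fun i _ ↦ ?_
      rw [D.leibniz, hD, Algebra.smul_def (ι (F i)), ResidueField.algebraMap_eq,
        (residue_eq_zero_iff _).mpr (hFm i), zero_mul, add_zero, Algebra.smul_def,
        ResidueField.algebraMap_eq, hb]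
      rfl
    let M : Matrix (Fin s) (Fin s) P.ResidueField :=
      (algebraMap _ P.ResidueField).mapMatrix
        (Matrix.of fun i j : Fin s => MvPolynomial.pderiv (c j) (F i))
    have hM : M.det ≠ 0 := by
      rwa [← RingHom.map_det, Ne, Ideal.algebraMap_residueField_eq_zero]
    refine fun i ↦ congrFun (Matrix.eq_zero_of_vecMul_eq_zero hM (v := g) ?_) i
    ext j
    exact hsum (c j)
  have hfin : finrank (ResidueField S) (CotangentSpace S) ≤ s := by
    have h1 := IsRegularLocalRing.iff_finrank_cotangentSpace (R := S).mp inferInstance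
    rw [IsLocalization.AtPrime.ringKrullDim_eq_height P S] at h1
    have h2 : P.height ≤ s :=
      (Ideal.height_le_card_of_mem_minimalPrimes_span (Set.finite_range F) hP).trans <|
        Nat.cast_le.mpr <| by
          rw [← Set.image_univ]
          exact (Set.ncard_image_le Set.finite_univ).trans_eq (by simp)
    rw [← WithBot.coe_le_coe, ← h1] at h2
    exact_mod_cast h2
  have hcard : Fintype.card (Fin s) = finrank (ResidueField S) (CotangentSpace S) :=
    le_antisymm hv.fintype_card_le_finrank (by simpa using hfin)
  have hspan := hv.span_eq_top_of_card_eq_finrank' hcard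
  rw [show Set.range v = (maximalIdeal S).toCotangent '' Set.range f from Set.range_comp _ _,
    CotangentSpace.span_image_eq_top_iff] at hspan
  have hmap : maximalIdeal S ≤ (Ideal.span (Set.range F)).map ι := by
    intro x hx
    have hx' : (⟨x, hx⟩ : maximalIdeal S) ∈ Submodule.span S (Set.range f) := hspan ▸ trivial
    have := Submodule.mem_map_of_mem (f := (maximalIdeal S).subtype) hx'
    rw [Submodule.map_span, ← Set.range_comp] at this
    rw [Ideal.map_span, ← Set.range_comp]
    exact this
  obtain ⟨t, ht, hta⟩ := (IsLocalization.algebraMap_mem_map_algebraMap_iff P.primeCompl S _ a).mp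
    (hmap ((IsLocalization.AtPrime.to_map_mem_maximal_iff S P a).mpr ha))
  exact ⟨t, ht, hta⟩

end Jacobian

section Dimension

theorem ringKrullDim_le_of_isIntegral {A B : Type*} [CommRing A] [CommRing B] [Algebra A B]
    [Algebra.IsIntegral A B] [FaithfulSMul A B] : ringKrullDim A ≤ ringKrullDim B := by
  refine iSup_le fun l ↦ ?_
  obtain ⟨Q, hQ⟩ := Algebra.IsIntegral.comap_surjective A B l.head
  have : Q.asIdeal.LiesOver (RelSeries.head l).asIdeal := ⟨by rw [← hQ]; rfl⟩
  obtain ⟨L, hL, -⟩ := Ideal.exists_ltSeries_of_hasGoingUp l Q.asIdeal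
  rw [← hL]
  exact Order.LTSeries.length_le_krullDim L

/-- The transcendence degree of the residue field of a prime `P` of a polynomial ring is at most
the dimension of the quotient by `P`. -/
theorem card_le_ringKrullDim_of_isTranscendenceBasis {K : Type*} [Field K] {n : ℕ}
    (P : Ideal (MvPolynomial (Fin n) K)) [P.IsPrime] {B : Finset P.ResidueField}
    (hB : IsTranscendenceBasis K ((↑) : B → P.ResidueField)) :
    (B.card : WithBot ℕ∞) ≤ ringKrullDim (MvPolynomial (Fin n) K ⧸ P) := by
  obtain ⟨r, -, g, hg, hintegral⟩ := exists_integral_inj_algHom_of_quotient P Ideal.IsPrime.ne_top'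
  let A := MvPolynomial (Fin r) K
  let _ : Algebra A (MvPolynomial (Fin n) K ⧸ P) := g.toRingHom.toAlgebra
  let _ : Algebra A P.ResidueField :=
    ((algebraMap (MvPolynomial (Fin n) K ⧸ P) P.ResidueField).comp g.toRingHom).toAlgebra
  have : IsScalarTower A (MvPolynomial (Fin n) K ⧸ P) P.ResidueField := .of_algebraMap_eq' rfl
  have : IsScalarTower K A (MvPolynomial (Fin n) K ⧸ P) :=
    .of_algebraMap_eq fun x ↦ (g.commutes x).symm
  have : IsScalarTower K A P.ResidueField := .to₁₂₄ K A (MvPolynomial (Fin n) K ⧸ P) _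
  have : Algebra.IsIntegral A (MvPolynomial (Fin n) K ⧸ P) := ⟨hintegral⟩
  have : FaithfulSMul A (MvPolynomial (Fin n) K ⧸ P) :=
    (faithfulSMul_iff_algebraMap_injective _ _).mpr hg
  have : FaithfulSMul A P.ResidueField := .trans A (MvPolynomial (Fin n) K ⧸ P) _
  have : Algebra.IsAlgebraic (MvPolynomial (Fin n) K ⧸ P) P.ResidueField :=
    IsLocalization.isAlgebraic _ (nonZeroDivisors (MvPolynomial (Fin n) K ⧸ P))
  have : Algebra.IsAlgebraic A P.ResidueField := .trans A (MvPolynomial (Fin n) K ⧸ P) _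
  have hr : B.card = r := by
    have h := trdeg_add_eq K A (A := P.ResidueField)
    rw [trdeg_eq_zero (R := A), ← hB.cardinalMk_eq_trdeg,
      MvPolynomial.trdeg_of_isDomain] at h
    simpa using h.symm
  rw [hr]
  refine le_trans ?_ (ringKrullDim_le_of_isIntegral (A := A))
  rw [MvPolynomial.ringKrullDim_of_isNoetherianRing, ringKrullDim_eq_zero_of_field]
  simp

/-- A derivation vanishing on a separating generating set is zero. -/
theorem Derivation.eq_zero_of_isSeparable {K L : Type*} [Field K] [Field L] [Algebra K L]
    {B : Set L} [Algebra.IsSeparable (IntermediateField.adjoin K B) L] (D : Derivation K L L)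
    (hD : ∀ b ∈ B, D b = 0) : D = 0 := by
  have hE {x : L} (hx : x ∈ IntermediateField.adjoin K B) : D x = 0 := by
    induction hx using IntermediateField.adjoin_induction with
    | mem x hx => exact hD x hx
    | algebraMap x => exact D.map_algebraMap x
    | add x y _ _ hx hy => rw [map_add, hx, hy, add_zero]
    | inv x _ hx => rw [D.leibniz_inv, hx, smul_zero]
    | mul x y _ _ hx hy => rw [D.leibniz, hx, hy, smul_zero, smul_zero, add_zero]
  let D' : Derivation (IntermediateField.adjoin K B) L L :=
    { toFun := D
      map_add' := map_add D
      map_smul' := fun e x ↦ by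
        rw [Algebra.smul_def, D.leibniz, IntermediateField.algebraMap_apply, hE e.2, smul_zero,
          add_zero]
        rfl
      map_one_eq_zero' := D.map_one_eq_zero
      leibniz' := D.leibniz }
  have := Algebra.FormallyUnramified.of_isSeparable (IntermediateField.adjoin K B) L
  ext x
  have h : D' x = 0 := by
    rw [← D'.liftKaehlerDifferential_comp_D, Subsingleton.elim (KaehlerDifferential.D _ L x) 0,
      map_zero]
  exact h

end Dimension

section JacobianRank

theorem Matrix.exists_strictMono_det_ne_zero {κ : Type*} [Field κ] {n s : ℕ}
    (M : Matrix (Fin s) (Fin n) κ) (hM : s ≤ M.rank) :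
    ∃ c : Fin s → Fin n, StrictMono c ∧ (M.submatrix id c).det ≠ 0 := by
  classical
  obtain ⟨ι, a, ha, hspan, hli⟩ := exists_linearIndependent' κ M.col
  have : Fintype ι := Fintype.ofInjective a ha
  let T : Finset (Fin n) := Finset.univ.image a
  have hT : T.card = s := by
    rw [Finset.card_image_of_injective _ ha, Finset.card_univ, ← finrank_span_eq_card hli, hspan,
      ← M.rank_eq_finrank_span_cols]
    exact le_antisymm (M.rank_le_height) hM
  let c := T.orderEmbOfFin hT
  have hc (i : Fin s) : ∃ j, a j = c i := by
    obtain ⟨j, -, hj⟩ := Finset.mem_image.mp (T.orderEmbOfFin_mem hT i)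
    exact ⟨j, hj⟩
  choose b hb using hc
  refine ⟨c, c.strictMono, ?_⟩
  have hbi : Function.Injective b := fun i j h ↦ c.injective (by rw [← hb, ← hb, h])
  have hcol : LinearIndependent κ (M.submatrix id c).col := by
    have : (M.submatrix id c).col = (M.col ∘ a) ∘ b := by
      ext i j
      simp [hb]
    rw [this]
    exact hli.comp b hbi
  rw [Matrix.linearIndependent_cols_iff_isUnit, Matrix.isUnit_iff_isUnit_det] at hcol
  exact hcol.ne_zero


/-- If `P` is locally generated by `F₁, …, F_s` and `dim K[X]/P ≤ n - s`, then some maximal minor of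
the Jacobian matrix does not vanish at `P`. -/
theorem exists_det_notMem {K : Type*} [Field K] [PerfectField K] {n s : ℕ} (hsn : s ≤ n)
    (F : Fin s → MvPolynomial (Fin n) K) (P : Ideal (MvPolynomial (Fin n) K)) [P.IsPrime]
    (hP : ∀ a ∈ P, ∃ t ∉ P, t * a ∈ Ideal.span (Set.range F))
    (hFP : Ideal.span (Set.range F) ≤ P)
    (hdim : ringKrullDim (MvPolynomial (Fin n) K ⧸ P) ≤ (n - s : ℕ)) :
    ∃ c : Fin s → Fin n, StrictMono c ∧
      Matrix.det (Matrix.of fun i j : Fin s => MvPolynomial.pderiv (c j) (F i)) ∉ P := by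
  let κ := P.ResidueField
  let ι := algebraMap (MvPolynomial (Fin n) K) κ
  have hι {x} : ι x = 0 ↔ x ∈ P := Ideal.algebraMap_residueField_eq_zero
  let M : Matrix (Fin s) (Fin n) κ := Matrix.of fun i j ↦ ι (MvPolynomial.pderiv j (F i))
  suffices hrank : s ≤ M.rank by
    obtain ⟨c, hc, hdet⟩ := M.exists_strictMono_det_ne_zero hrank
    refine ⟨c, hc, fun h ↦ hdet ?_⟩
    rw [← hι, RingHom.map_det] at h
    exact h
  have : Algebra.EssFiniteType K κ := .comp K (MvPolynomial (Fin n) K) κ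
  obtain ⟨B, hB, hsep⟩ := exists_isTranscendenceBasis_and_isSeparable_of_perfectField K κ
  have hBcard : B.card ≤ n - s := by
    exact_mod_cast (card_le_ringKrullDim_of_isTranscendenceBasis P hB).trans hdim
  let ev : Derivation K κ κ →ₗ[κ] (B → κ) :=
    { toFun := fun D b ↦ D b
      map_add' := fun _ _ ↦ rfl
      map_smul' := fun _ _ ↦ rfl }
  have hev : Function.Injective ev := by
    refine (injective_iff_map_eq_zero ev).mpr fun D hD ↦ ?_
    exact D.eq_zero_of_isSeparable (B := B) fun b hb ↦ congrFun hD ⟨b, hb⟩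
  have : Module.Finite κ (Derivation K κ κ) := .of_injective ev hev
  have hder : finrank κ (Derivation K κ κ) ≤ B.card := by
    simpa using LinearMap.finrank_le_finrank_of_injective hev
  let ρ : Derivation K κ κ →ₗ[κ] (Fin n → κ) :=
    { toFun := fun D j ↦ D (ι (MvPolynomial.X j))
      map_add' := fun _ _ ↦ rfl
      map_smul' := fun _ _ ↦ rfl }
  have hker : LinearMap.ker M.mulVecLin ≤ LinearMap.range ρ := by
    intro v hv
    let D := MvPolynomial.mkDerivation K v
    have hDF (i : Fin s) : D (F i) = 0 := by
      rw [MvPolynomial.mkDerivation_eq_sum_pderiv]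
      exact congrFun hv i
    have hsmul {x} (hx : x ∈ P) (y : κ) : x • y = 0 := by
      rw [Algebra.smul_def]
      exact mul_eq_zero_of_left (hι.mpr hx) y
    have hDI {x} (hx : x ∈ Ideal.span (Set.range F)) : D x = 0 := by
      induction hx using Submodule.span_induction with
      | mem x hx =>
        obtain ⟨i, rfl⟩ := hx
        exact hDF i
      | zero => exact map_zero D
      | add x y _ _ hx hy => rw [map_add, hx, hy, add_zero]
      | smul a x hx h => rw [smul_eq_mul, D.leibniz, h, hsmul (hFP hx), smul_zero, add_zero]
    have hDP {x} (hx : x ∈ P) : D x = 0 := by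
      obtain ⟨t, ht, htx⟩ := hP x hx
      have h := hDI htx
      rw [D.leibniz, hsmul hx, add_zero, Algebra.smul_def] at h
      exact (mul_eq_zero.mp h).resolve_left fun h0 ↦ ht (hι.mp h0)
    obtain ⟨D₀, hD₀⟩ := D.exists_lift_of_surjective (B := MvPolynomial (Fin n) K ⧸ P)
      Ideal.Quotient.mk_surjective fun x hx ↦ hDP (Ideal.Quotient.eq_zero_iff_mem.mp hx)
    obtain ⟨D₁, hD₁⟩ := Derivation.exists_extension_of_isLocalization (S := κ)
      (nonZeroDivisors (MvPolynomial (Fin n) K ⧸ P)) D₀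
    refine ⟨D₁, funext fun j ↦ ?_⟩
    have h := hD₁ (algebraMap (MvPolynomial (Fin n) K) _ (MvPolynomial.X j))
    rw [hD₀, MvPolynomial.mkDerivation_X] at h
    exact h
  have h1 := (Submodule.finrank_mono hker).trans (LinearMap.finrank_range_le ρ)
  have h2 := LinearMap.finrank_range_add_finrank_ker M.mulVecLin
  rw [finrank_fin_fun] at h2
  change M.rank + _ = n at h2
  omega

end JacobianRank

/-- A radical ideal agrees locally with each of its minimal primes. -/
theorem Ideal.IsRadical.exists_mul_mem_of_mem_minimalPrimes {R : Type*} [CommRing R] {I P : Ideal R}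
    (hI : I.IsRadical) (hP : P ∈ I.minimalPrimes) {a : R} (ha : a ∈ P) : ∃ t ∉ P, t * a ∈ I := by
  have := hP.1.1
  let S := Localization.AtPrime P
  have h : algebraMap R S a ∈ (I.map (algebraMap R S)).radical := by
    rw [IsLocalization.AtPrime.radical_map_of_mem_minimalPrimes S P I hP]
    exact Ideal.mem_map_of_mem _ ha
  obtain ⟨k, hk⟩ := h
  rw [← map_pow, IsLocalization.algebraMap_mem_map_algebraMap_iff P.primeCompl] at hk
  obtain ⟨t, ht, hta⟩ := hk
  refine ⟨t, ht, hI ⟨k + 1, ?_⟩⟩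
  rw [show (t * a) ^ (k + 1) = t ^ k * a * (t * a ^ k) by ring]
  exact I.mul_mem_left _ hta


/-- Let `K` be a perfect field and `I = (F₁, …, F_s) ⊆ K[X₁, …, Xₙ]` an ideal
such that the Krull dimension of `K[X₁, …, Xₙ]/I` equals `n − s`.  Let `J` be the ideal
generated by `I` together with all `s × s` minors of the Jacobian matrix `(∂F_i/∂X_j)`.
Then `I` is radical iff `J` is not contained in any minimal prime of `I`. -/
theorem stmt_0 {K : Type*} [Field K] [PerfectField K] (n s : ℕ) (hsn : s ≤ n)
    (F : Fin s → MvPolynomial (Fin n) K)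
    (I J : Ideal (MvPolynomial (Fin n) K))
    (hI : I = Ideal.span (Set.range F))
    (hdim : ringKrullDim (MvPolynomial (Fin n) K ⧸ I) = ((n - s : ℕ) : WithBot ℕ∞))
    (hJ : J = I ⊔ Ideal.span {m : MvPolynomial (Fin n) K |
      ∃ c : Fin s → Fin n, StrictMono c ∧
        m = Matrix.det (Matrix.of fun i j : Fin s => MvPolynomial.pderiv (c j) (F i))}) :
    I.IsRadical ↔ ∀ P ∈ I.minimalPrimes, ¬ J ≤ P := by
  subst hI
  constructor
  · intro hrad P hP hJP
    have := hP.1.1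
    have hPdim : ringKrullDim (MvPolynomial (Fin n) K ⧸ P) ≤ (n - s : ℕ) :=
      (ringKrullDim_le_of_surjective (Ideal.Quotient.factor hP.1.2)
        (Ideal.Quotient.factor_surjective _)).trans hdim.le
    obtain ⟨c, hc, hdet⟩ := exists_det_notMem hsn F P
      (fun a ha ↦ hrad.exists_mul_mem_of_mem_minimalPrimes hP ha) hP.1.2 hPdim
    exact hdet (hJP (hJ ▸ Ideal.mem_sup_right (Ideal.subset_span ⟨c, hc, rfl⟩)))
  · intro h a ha
    by_contra haI
    obtain ⟨Q, hQ, hle⟩ := exists_le_isAssociatedPrime_of_isNoetherianRing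
      (MvPolynomial (Fin n) K) (Ideal.Quotient.mk (Ideal.span (Set.range F)) a)
      (by rwa [Ne, Ideal.Quotient.eq_zero_iff_mem])
    have hQmin := mem_minimalPrimes_of_mem_associatedPrimes hsn F hdim.le hQ
    obtain ⟨c, hc⟩ : ∃ c : Fin s → Fin n,
        Matrix.det (Matrix.of fun i j : Fin s => MvPolynomial.pderiv (c j) (F i)) ∉ Q := by
      by_contra! hcon
      refine h Q hQmin (hJ ▸ sup_le hQmin.1.2 (Ideal.span_le.mpr ?_))
      rintro _ ⟨c, -, rfl⟩
      exact hcon c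
    have haQ : a ∈ Q := hQmin.1.1.radical_le_iff.mpr hQmin.1.2 ha
    obtain ⟨t, ht, hta⟩ := exists_mul_mem_span_of_det_notMem F hQmin c hc haQ
    refine ht (hle ?_)
    rw [Submodule.mem_colon_singleton, Submodule.mem_bot]
    exact Ideal.Quotient.eq_zero_iff_mem.mpr hta
end

section
/- Let K be a field, V ⊆ K̄^n an equidimensional K-variety of dimension n − s with I(V) = (F_1, ..., F_s), and Y_1, ..., Y_n ∈ K[X_1, ..., X_n] linearly independent linear forms such that the mapping π : V → K̄^{n−s} defined by Y_1, ..., Y_{n−s} is a finite morphism. Set R := K[Y_1, ..., Y_{n−s}] and assume K[V] is a free R-module of finite rank D. Fix 0 ≤ j ≤ n − s and p_1, ..., p_j ∈ K, and let J_j := (F_1, ..., F_s) + (Y_1 − p_1, ..., Y_j − p_j) ⊆ K[X_1, ..., X_n]. Then K[X_1, ..., X_n]/J_j is a free K[Y_{j+1}, ..., Y_{n−s}]-module of rank D; moreover, if G_1, ..., G_D ∈ K[X_1, ..., X_n] induce a basis of K[V] as an R-module, then their images in K[X_1, ..., X_n]/J_j form a basis of this quotient as a K[Y_{j+1}, ...,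 Y_{n−s}]-module. -/
open MvPolynomial

noncomputable section

/-- The zero set, in affine `n`-space over the algebraic closure of `K`, of a set of
polynomials with coefficients in `K`. -/
def mvZeroSet {K : Type*} [Field K] {n : ℕ} (S : Set (MvPolynomial (Fin n) K)) :
    Set (Fin n → AlgebraicClosure K) :=
  {x | ∀ f ∈ S, MvPolynomial.aeval x f = 0}
/-- The vanishing ideal, in `K[X₁, …, Xₙ]`, of a subset of affine `n`-space over the
algebraic closure of `K`. -/
def mvVanishingIdeal {K : Type*} [Field K] {n : ℕ}
    (V : Set (Fin n → AlgebraicClosure K)) : Ideal (MvPolynomial (Fin n) K) :=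
  { carrier := {f | ∀ x ∈ V, MvPolynomial.aeval x f = 0}
    add_mem' := by
      intro a b ha hb x hx
      simp only [Set.mem_setOf_eq] at ha hb ⊢
      simp [map_add, ha x hx, hb x hx]
    zero_mem' := by intro x hx; simp
    smul_mem' := by
      intro c a ha x hx
      simp only [Set.mem_setOf_eq] at ha ⊢
      simp [smul_eq_mul, ha x hx] }
/-- The `K`-algebra homomorphism `K[Z₁, …, Z_m] → K[X₁, …, Xₙ]/I` sending `Z_i` to the class
of `Y_i`. -/
def coordMap {K : Type*} [Field K] {n m : ℕ} (I : Ideal (MvPolynomial (Fin n) K))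
    (Y : Fin m → MvPolynomial (Fin n) K) :
    MvPolynomial (Fin m) K →ₐ[K] (MvPolynomial (Fin n) K ⧸ I) :=
  MvPolynomial.aeval fun i => Ideal.Quotient.mk I (Y i)
/-- `g` is a basis of `K[X₁, …, Xₙ]/I` as a module over `K[Y₁, …, Y_m]`
(acting through `coordMap I Y`). -/
def IsFreeBasisOver {K : Type*} [Field K] {n m D : ℕ} (I : Ideal (MvPolynomial (Fin n) K))
    (Y : Fin m → MvPolynomial (Fin n) K)
    (g : Fin D → MvPolynomial (Fin n) K ⧸ I) : Prop :=
  (∀ b : MvPolynomial (Fin n) K ⧸ I, ∃ c : Fin D → MvPolynomial (Fin m) K,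
      b = ∑ i, coordMap I Y (c i) * g i) ∧
  (∀ c : Fin D → MvPolynomial (Fin m) K, (∑ i, coordMap I Y (c i) * g i) = 0 → ∀ i, c i = 0)


/-- The images of a basis of `K[X]/I` over `K[Y₁, …, Y_m]` form a basis after specializing the
coordinates `Y (a k)` to constants, over the polynomial ring in the remaining coordinates
`Y (b l)`. -/
theorem IsFreeBasisOver.specialize {K : Type*} [Field K] {n m r j D : ℕ}
    {I : Ideal (MvPolynomial (Fin n) K)} {Y : Fin m → MvPolynomial (Fin n) K}
    {G : Fin D → MvPolynomial (Fin n) K}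
    (hG : IsFreeBasisOver I Y (fun i => Ideal.Quotient.mk I (G i)))
    (a : Fin j → Fin m) (b : Fin r → Fin m) (p : Fin j → K)
    (ev : MvPolynomial (Fin m) K →ₐ[K] MvPolynomial (Fin r) K)
    (hab : ∀ i, (∃ k, a k = i) ∨ ∃ l, b l = i)
    (hev_a : ∀ k, ev (X (a k)) = C (p k)) (hev_b : ∀ l, ev (X (b l)) = X l) :
    IsFreeBasisOver (I ⊔ Ideal.span (Set.range fun k => Y (a k) - C (p k)))
      (fun l => Y (b l)) (fun i => Ideal.Quotient.mk _ (G i)) := by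
  set J := I ⊔ Ideal.span (Set.range fun k => Y (a k) - C (p k))
  have coordMap_eq {N : ℕ} (L : Ideal (MvPolynomial (Fin n) K))
      (y : Fin N → MvPolynomial (Fin n) K) (c : MvPolynomial (Fin N) K) :
      coordMap L y c = Ideal.Quotient.mk L (aeval y c) := by
    have : coordMap L y = (Ideal.Quotient.mkₐ K L).comp (aeval y) := by
      ext i; simp [coordMap]
    rw [this]; rfl
  have coordMap_ev (c : MvPolynomial (Fin m) K) :
      coordMap J (fun l => Y (b l)) (ev c) = coordMap J Y c := by
    have : (coordMap J (fun l => Y (b l))).comp ev = coordMap J Y := by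
      apply MvPolynomial.algHom_ext
      intro i
      rcases hab i with ⟨k, rfl⟩ | ⟨l, rfl⟩
      · rw [AlgHom.comp_apply, hev_a, coordMap_eq, coordMap_eq, eq_comm, Ideal.Quotient.eq]
        have hk : Y (a k) - C (p k) ∈ J := Ideal.mem_sup_right (Ideal.subset_span ⟨k, rfl⟩)
        simpa using hk
      · rw [AlgHom.comp_apply, hev_b]
        simp [coordMap]
    rw [← this]; rfl
  have ev_rename (c : MvPolynomial (Fin r) K) : ev (rename b c) = c := by
    have : ev.comp (rename b) = AlgHom.id K _ := by
      ext1 l; simp [hev_b]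
    exact DFunLike.congr_fun this c
  refine ⟨fun f => ?_, fun c hc => ?_⟩
  · obtain ⟨f, rfl⟩ := Ideal.Quotient.mk_surjective f
    obtain ⟨c, hc⟩ := hG.1 (Ideal.Quotient.mk I f)
    refine ⟨fun i => ev (c i), ?_⟩
    simp only [coordMap_ev]
    simp only [coordMap_eq, ← map_mul, ← map_sum] at hc ⊢
    rw [Ideal.Quotient.eq] at hc ⊢
    exact Ideal.mem_sup_left hc
  · have hmem : ∑ i, aeval Y (rename b (c i)) * G i ∈ J := by
      rw [← Ideal.Quotient.eq_zero_iff_mem, ← hc]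
      simp only [coordMap_eq, aeval_rename, Function.comp_def, map_sum, map_mul]
    obtain ⟨u, hu, v, hv, huv⟩ := Submodule.mem_sup.1 hmem
    obtain ⟨h, rfl⟩ := (Ideal.mem_span_range_iff_exists_fun).1 hv
    choose d hd using fun k => hG.1 (Ideal.Quotient.mk I (h k))
    have key := hG.2 (fun i => rename b (c i) - ∑ k, d k i * (X (a k) - C (p k))) (by
      have hsum : Ideal.Quotient.mk I (∑ i, aeval Y (rename b (c i)) * G i)
          = ∑ k, (∑ i, coordMap I Y (d k i) * Ideal.Quotient.mk I (G i)) *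
            Ideal.Quotient.mk I (Y (a k) - C (p k)) := by
        rw [← huv, map_add, Ideal.Quotient.eq_zero_iff_mem.2 hu, zero_add, map_sum]
        exact Finset.sum_congr rfl fun k _ => by rw [map_mul, hd k]
      have hX (k : Fin j) : coordMap I Y (X (a k) - C (p k))
          = Ideal.Quotient.mk I (Y (a k) - C (p k)) := by
        simp [coordMap_eq]
      simp only [map_sub (coordMap I Y), map_sum (coordMap I Y), sub_mul,
        Finset.sum_sub_distrib, map_mul (coordMap I Y), Finset.sum_mul]
      rw [sub_eq_zero]
      simp only [← map_sub (coordMap I Y), hX]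
      rw [map_sum] at hsum
      simp only [map_mul, ← coordMap_eq, Finset.sum_mul] at hsum
      rw [hsum, Finset.sum_comm]
      exact Finset.sum_congr rfl fun i _ => Finset.sum_congr rfl fun k _ => mul_right_comm _ _ _)
    intro i
    have hi := congrArg ev (key i)
    have hC (k : Fin j) : ev (C (p k)) = C (p k) := ev.commutes (p k)
    simpa [ev_rename, hev_a, hC] using hi

/-- Lemma 4.1 of the paper. -/
theorem stmt_4 {K : Type*} [Field K] (n s D j : ℕ) (hsn : s ≤ n) (hj : j ≤ n - s)
    (V : Set (Fin n → AlgebraicClosure K))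
    (F : Fin s → MvPolynomial (Fin n) K)
    (hV : V = mvZeroSet (Set.range F))
    (hIV : mvVanishingIdeal V = Ideal.span (Set.range F))
    (hequi : ∀ P ∈ (mvVanishingIdeal V).minimalPrimes,
      ringKrullDim (MvPolynomial (Fin n) K ⧸ P) = ((n - s : ℕ) : WithBot ℕ∞))
    (Y : Fin n → MvPolynomial (Fin n) K)
    (hYhom : ∀ i, (Y i).IsHomogeneous 1)
    (hYind : LinearIndependent K Y)
    -- `π : V → K̄^{n−s}` defined by `Y₁, …, Y_{n−s}` is a finite morphism
    (hfin : Function.Injective (coordMap (mvVanishingIdeal V)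
        (fun i : Fin (n - s) => Y ⟨(i : ℕ), by have := i.2; omega⟩)) ∧
      RingHom.IsIntegral (coordMap (mvVanishingIdeal V)
        (fun i : Fin (n - s) => Y ⟨(i : ℕ), by have := i.2; omega⟩)).toRingHom)
    -- `G₁, …, G_D` induce a basis of `K[V]` as an `R = K[Y₁, …, Y_{n−s}]`-module
    (G : Fin D → MvPolynomial (Fin n) K)
    (hG : IsFreeBasisOver (mvVanishingIdeal V)
      (fun i : Fin (n - s) => Y ⟨(i : ℕ), by have := i.2; omega⟩)
      (fun i => Ideal.Quotient.mk (mvVanishingIdeal V) (G i)))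
    (p : Fin j → K) :
    -- the images of `G₁, …, G_D` form a basis of `K[X]/𝒥_j` as a
    -- `K[Y_{j+1}, …, Y_{n−s}]`-module; in particular this quotient is free of rank `D`
    IsFreeBasisOver
      (Ideal.span (Set.range F) ⊔ Ideal.span (Set.range fun i : Fin j =>
        Y ⟨(i : ℕ), by have := i.2; omega⟩ - MvPolynomial.C (p i)))
      (fun i : Fin (n - s - j) => Y ⟨j + (i : ℕ), by have := i.2; omega⟩)
      (fun i => Ideal.Quotient.mk _ (G i)) := by
  rw [← hIV]
  refine hG.specialize (fun k : Fin j => ⟨k, by have := k.2; omega⟩)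
    (fun l : Fin (n - s - j) => ⟨j + l, by have := l.2; omega⟩) p
    (aeval fun i : Fin (n - s) => if h : (i : ℕ) < j then C (p ⟨i, h⟩)
      else X ⟨i - j, by have := i.2; omega⟩) (fun i => ?_) (fun k => ?_) (fun l => ?_)
  · by_cases h : (i : ℕ) < j
    · exact Or.inl ⟨⟨i, h⟩, rfl⟩
    · exact Or.inr ⟨⟨i - j, by have := i.2; omega⟩, Fin.ext (by simp; omega)⟩
  · simp
  · simp
end
end

section
/- Let K be a perfect field, V ⊆ K̄^n an equidimensional K-variety of dimension n − s with I(V) = (F_1, ..., F_s), and Y_1, ..., Y_n ∈ K[X_1, ..., X_n] linearly independent linear forms such that the mapping π : V → K̄^{n−s} defined by Y_1, ..., Y_{n−s} is a finite morphism; set R := K[Y_1, ..., Y_{n−s}] and assume K[V] is a free R-module of finite rank D. Let p = (p_1, ..., p_{n−s}) ∈ K^{n−s} be a lifting point of π, fix 0 ≤ j ≤ n − s and let J_j := (F_1, ..., F_s) + (Y_1 − p_1, ..., Y_j − p_j). Then J_j is a radical ideal, every minimal prime of J_j has coheight s + j (so J_j is unmixed and K[X_1,...,X_n]/J_j has Krull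 dimension n − s − j), and the structure map K[Y_{j+1}, ..., Y_{n−s}] → K[X_1, ..., X_n]/J_j is injective with integral (finite) extension, i.e., the mapping defined by Y_{j+1}, ..., Y_{n−s} from the zero set of J_j to K̄^{n−s−j} is a finite morphism. -/
open MvPolynomial

noncomputable section

/-- The Jacobian matrix of `Y₁, …, Y_{n-s}, F₁, …, F_s` with respect to `X₁, …, Xₙ`. -/
def jacMat {K : Type*} [Field K] (n s : ℕ) (hsn : s ≤ n)
    (Y : Fin (n - s) → MvPolynomial (Fin n) K) (F : Fin s → MvPolynomial (Fin n) K) :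
    Matrix (Fin n) (Fin n) (MvPolynomial (Fin n) K) :=
  Matrix.of fun i j =>
    if h : (i : ℕ) < n - s then MvPolynomial.pderiv j (Y ⟨(i : ℕ), h⟩)
    else MvPolynomial.pderiv j (F ⟨(i : ℕ) - (n - s), by have h2 := i.2; omega⟩)
/-- The fiber `π⁻¹(p)` of the projection `π : V → 𝔸^m` given by the linear forms `Y`. -/
def fiberSet {K : Type*} [Field K] {n m : ℕ} (V : Set (Fin n → AlgebraicClosure K))
    (Y : Fin m → MvPolynomial (Fin n) K) (p : Fin m → K) :
    Set (Fin n → AlgebraicClosure K) :=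
  {x | x ∈ V ∧ ∀ i, MvPolynomial.aeval x (Y i) = algebraMap K (AlgebraicClosure K) (p i)}
/-- `p` is a lifting point of the projection `π : V → 𝔸^{n-s}` with respect to `F₁, …, F_s`:
the Jacobian determinant of `Y₁, …, Y_{n-s}, F₁, …, F_s` does not vanish at any point of the
fiber `π⁻¹(p)`. -/
def IsLiftingPoint {K : Type*} [Field K] (n s : ℕ) (hsn : s ≤ n)
    (V : Set (Fin n → AlgebraicClosure K))
    (Y : Fin (n - s) → MvPolynomial (Fin n) K) (F : Fin s → MvPolynomial (Fin n) K)
    (p : Fin (n - s) → K) : Prop :=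
  ∀ x ∈ fiberSet V Y p, MvPolynomial.aeval x (jacMat n s hsn Y F).det ≠ 0
open TensorProduct

theorem ringKrullDim_eq_of_isIntegral_of_injective {R S : Type*} [CommRing R] [CommRing S]
    [Algebra R S] [Algebra.IsIntegral R S]
    (h : Function.Injective (algebraMap R S)) : ringKrullDim S = ringKrullDim R := by
  have hmono : StrictMono (PrimeSpectrum.comap (algebraMap R S)) := fun I J hIJ =>
    Ideal.IsIntegral.comap_lt_comap (R := R) (I := I.asIdeal) (J := J.asIdeal) hIJ
  refine le_antisymm (Order.krullDim_le_of_strictMono _ hmono) ?_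
  refine iSup_le fun l => ?_
  obtain ⟨Q, -, hQ, hQl⟩ := Ideal.exists_ideal_over_prime_of_isIntegral
    (R := R) (S := S) l.head.asIdeal ⊥ (by
      rw [← RingHom.ker_eq_comap_bot, (RingHom.injective_iff_ker_eq_bot _).mp h]; exact bot_le)
  have hco := Order.coheight_eq_of_strictMono _ hmono (fun I p hIp => by
    obtain ⟨Q, hIQ, hQ, hQp⟩ := Ideal.exists_ideal_over_prime_of_isIntegral
      p.asIdeal I.asIdeal hIp.le
    have hQp' : PrimeSpectrum.comap (algebraMap R S) ⟨Q, hQ⟩ = p := PrimeSpectrum.ext hQp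
    refine ⟨⟨Q, hQ⟩, lt_of_le_of_ne hIQ ?_, hQp'⟩
    rintro rfl
    exact hIp.ne hQp') ⟨Q, hQ⟩
  have hhead : PrimeSpectrum.comap (algebraMap R S) ⟨Q, hQ⟩ = l.head := PrimeSpectrum.ext hQl
  rw [hhead] at hco
  refine le_trans ?_ (Order.coheight_le_krullDim (⟨Q, hQ⟩ : PrimeSpectrum S))
  rw [hco]
  exact WithBot.coe_le_coe.mpr Order.length_le_coheight_head

theorem isReduced_of_smul_kaehlerDifferential_eq_zero {R B : Type*} [CommRing R] [IsDomain R]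
    [CommRing B] [Algebra R B] [Module.Finite R B] [Module.Free R B] {r : R} (hr : r ≠ 0) {d : B}
    (hrd : algebraMap R B r ∈ Ideal.span {d}) (hd : ∀ ω : Ω[B⁄R], d • ω = 0) : IsReduced B := by
  have h : ∀ ω : Ω[B⁄R], r • ω = 0 := fun ω => by
    obtain ⟨e, he⟩ := Ideal.mem_span_singleton.mp hrd
    rw [← algebraMap_smul B r ω, he, mul_comm, mul_smul, hd, smul_zero]
  let L := FractionRing R
  have hL : algebraMap R L r ≠ 0 := by
    simpa using hr
  have : Subsingleton (L ⊗[R] Ω[B⁄R]) := by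
    refine subsingleton_of_forall_eq 0 fun t => ?_
    induction t with
    | zero => rfl
    | add x y hx hy => rw [hx, hy, add_zero]
    | tmul l ω =>
      have : l = r • ((algebraMap R L r)⁻¹ * l) := by
        rw [Algebra.smul_def, mul_inv_cancel_left₀ hL]
      rw [this, TensorProduct.smul_tmul, h, TensorProduct.tmul_zero]
  let _ : Algebra B (L ⊗[R] B) := Algebra.TensorProduct.rightAlgebra
  have : Algebra.FormallyUnramified L (L ⊗[R] B) :=
    ⟨(KaehlerDifferential.tensorKaehlerEquivBase R L B (L ⊗[R] B)).symm.injective.subsingleton⟩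
  have : IsReduced (L ⊗[R] B) := Algebra.FormallyUnramified.isReduced_of_field L _
  exact isReduced_of_injective
    (Algebra.TensorProduct.includeRight : B →ₐ[R] L ⊗[R] B)
    (Algebra.TensorProduct.includeRight_injective (IsFractionRing.injective R L))

theorem derivation_apply_eq_sum_pderiv {σ R M : Type*} [Fintype σ] [CommRing R] [AddCommGroup M]
    [Module R M] [Module (MvPolynomial σ R) M] [IsScalarTower R (MvPolynomial σ R) M]
    (D : Derivation R (MvPolynomial σ R) M) (f : MvPolynomial σ R) :
    D f = ∑ k, pderiv k f • D (X k) := by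
  classical
  induction f using MvPolynomial.induction_on with
  | C a => simp
  | add f g hf hg => simp only [map_add, hf, hg, add_smul, Finset.sum_add_distrib]
  | mul_X f i hf =>
    simp only [Derivation.leibniz, pderiv_X, smul_eq_mul, add_smul, Finset.sum_add_distrib,
      mul_smul, ← Finset.smul_sum, ← hf]
    simp [Pi.single_apply, ite_smul]

theorem det_pderiv_smul_kaehlerDifferential_eq_zero {σ K R B : Type*} [Fintype σ]
    [DecidableEq σ] [CommRing K] [CommRing R] [Algebra K R] [CommRing B] [Algebra K B]
    [Algebra (MvPolynomial σ K) B] [IsScalarTower K (MvPolynomial σ K) B]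
    [Algebra R B] [IsScalarTower K R B]
    (hB : Function.Surjective (algebraMap (MvPolynomial σ K) B))
    (G : σ → MvPolynomial σ K)
    (hG : ∀ i, KaehlerDifferential.D R B (algebraMap _ B (G i)) = 0) (ω : Ω[B⁄R]) :
    algebraMap _ B (Matrix.of fun i k => pderiv k (G i)).det • ω = 0 := by
  let D' : Derivation K (MvPolynomial σ K) Ω[B⁄R] :=
    ((KaehlerDifferential.D R B).restrictScalars K).compAlgebraMap (MvPolynomial σ K)
  have hD' : ∀ f, D' f = KaehlerDifferential.D R B (algebraMap _ B f) := fun f => rfl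
  set M : Matrix σ σ (MvPolynomial σ K) := Matrix.of fun i k => pderiv k (G i)
  have hrow : ∀ i, ∑ k, M i k • D' (X k) = 0 := fun i => by
    rw [← hG i, ← hD', derivation_apply_eq_sum_pderiv D' (G i)]; rfl
  have hX : ∀ k, M.det • D' (X k) = 0 := fun k => by
    have h1 : ∑ l, (M.adjugate * M) k l • D' (X l) = 0 := by
      simp only [Matrix.mul_apply, Finset.sum_smul, mul_smul]
      rw [Finset.sum_comm]
      simp [← Finset.smul_sum, hrow]
    simpa [Matrix.adjugate_mul, Matrix.smul_apply, Matrix.one_apply, ite_smul] using h1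
  have hω : ω ∈ Submodule.span B (Set.range (KaehlerDifferential.D R B)) := by
    rw [KaehlerDifferential.span_range_derivation]; trivial
  induction hω using Submodule.span_induction with
  | zero => simp
  | add x y _ _ hx hy => rw [smul_add, hx, hy, add_zero]
  | smul a x _ hx => rw [smul_comm, hx, smul_zero]
  | mem x hx =>
    obtain ⟨b, rfl⟩ := hx
    obtain ⟨f, rfl⟩ := hB b
    rw [← hD', derivation_apply_eq_sum_pderiv D' f, Finset.smul_sum]
    refine Finset.sum_eq_zero fun k _ => ?_
    rw [algebraMap_smul, smul_comm, hX, smul_zero]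

theorem exists_aeval_eq_zero_of_ne_top {σ K : Type*} [Finite σ] [Field K]
    {I : Ideal (MvPolynomial σ K)} (hI : I ≠ ⊤) :
    ∃ x : σ → AlgebraicClosure K, ∀ f ∈ I, aeval x f = 0 := by
  obtain ⟨M, hM, hIM⟩ := Ideal.exists_le_maximal I hI
  let _ := Ideal.Quotient.field M
  have : Module.Finite K (MvPolynomial σ K ⧸ M) := finite_of_finite_type_of_isJacobsonRing _ _
  let e : (MvPolynomial σ K ⧸ M) →ₐ[K] AlgebraicClosure K := IsAlgClosed.lift
  refine ⟨fun i => e (Ideal.Quotient.mk M (X i)), fun f hf => ?_⟩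
  have : aeval (fun i => e (Ideal.Quotient.mk M (X i))) = e.comp (Ideal.Quotient.mkₐ K M) := by
    ext i; simp
  rw [this]
  simp [Ideal.Quotient.eq_zero_iff_mem.mpr (hIM hf)]

theorem exists_sub_one_mem_and_algebraMap_mem_span_singleton {R B : Type*} [CommRing R]
    [CommRing B] [Algebra R B] [Module.Finite R B] {m : Ideal R} {d : B}
    (h : Ideal.span {d} ⊔ m.map (algebraMap R B) = ⊤) :
    ∃ r : R, r - 1 ∈ m ∧ algebraMap R B r ∈ Ideal.span {d} := by
  obtain ⟨r, hr, hr'⟩ := Submodule.exists_sub_one_mem_and_smul_le_of_fg_of_le_sup (I := m)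
    (N := (Ideal.span {d}).restrictScalars R) (Module.Finite.fg_top (R := R) (M := B)) le_rfl
    fun b _ => by
      obtain ⟨x, hx, y, hy, rfl⟩ := Submodule.mem_sup.mp (h ▸ Submodule.mem_top (x := b))
      refine Submodule.add_mem_sup hx ?_
      rwa [Ideal.smul_top_eq_map]
  refine ⟨r, hr, ?_⟩
  rw [Algebra.algebraMap_eq_smul_one]
  exact hr' (Submodule.smul_mem_pointwise_smul 1 r ⊤ trivial)

theorem ringKrullDim_quotient_of_mem_minimalPrimes {P R : Type*} [CommRing P] [CommRing R]
    [IsDomain R] {J : Ideal P} (φ : R →+* P ⧸ J) (hφ : φ.IsIntegral)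
    (hreg : ∀ r ≠ 0, φ r ∈ nonZeroDivisors (P ⧸ J)) {Q : Ideal P} (hQ : Q ∈ J.minimalPrimes) :
    ringKrullDim (P ⧸ Q) = ringKrullDim R := by
  rw [Ideal.minimalPrimes_eq_comap] at hQ
  obtain ⟨q, hq, rfl⟩ := hQ
  let ψ : R →+* (P ⧸ J) ⧸ q := (Ideal.Quotient.mk q).comp φ
  let _ : Algebra R ((P ⧸ J) ⧸ q) := ψ.toAlgebra
  have : Algebra.IsIntegral R ((P ⧸ J) ⧸ q) := ⟨hφ.trans _ _
    (RingHom.isIntegral_of_surjective _ Ideal.Quotient.mk_surjective)⟩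
  have hinj : Function.Injective (algebraMap R ((P ⧸ J) ⧸ q)) := by
    rw [injective_iff_map_eq_zero]
    intro r hr
    by_contra hr0
    exact Set.disjoint_left.mp (Ideal.disjoint_nonZeroDivisors_of_mem_minimalPrimes hq)
      (Ideal.Quotient.eq_zero_iff_mem.mp hr) (hreg r hr0)
  rw [← ringKrullDim_eq_of_isIntegral_of_injective hinj]
  let f : P →+* (P ⧸ J) ⧸ q := (Ideal.Quotient.mk q).comp (Ideal.Quotient.mk J)
  have hf : Function.Surjective f :=
    Ideal.Quotient.mk_surjective.comp Ideal.Quotient.mk_surjective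
  have hker : RingHom.ker f = q.comap (Ideal.Quotient.mk J) := by
    rw [← RingHom.comap_ker, Ideal.mk_ker]
  rw [← hker]
  exact ringKrullDim_eq_of_ringEquiv (RingHom.quotientKerEquivOfSurjective hf)

theorem exists_basis_of_ker_le_map {ι R S A B : Type*} [Fintype ι] [CommRing R] [CommRing S]
    [CommRing A] [CommRing B] [Algebra R A] [Algebra S B] (g : Module.Basis ι R A)
    (σ : R →+* S) (hσ : Function.Surjective σ) (q : A →+* B) (hq : Function.Surjective q)
    (hcomp : ∀ r, algebraMap S B (σ r) = q (algebraMap R A r))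
    (hker : RingHom.ker q ≤ (RingHom.ker σ).map (algebraMap R A)) :
    Nonempty (Module.Basis ι S B) := by
  have hsum : ∀ c : ι → R, q (∑ i, c i • g i) = ∑ i, σ (c i) • q (g i) := fun c => by
    simp [Algebra.smul_def, hcomp]
  refine ⟨Module.Basis.mk (v := fun i => q (g i)) ?_ ?_⟩
  · rw [Fintype.linearIndependent_iff]
    intro c hc
    choose e he using fun i => hσ (c i)
    have hmem : (∑ i, e i • g i) ∈ RingHom.ker σ • (⊤ : Submodule R A) := by
      rw [Ideal.smul_top_eq_map]
      refine hker ?_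
      rw [RingHom.mem_ker, hsum]
      simpa [he] using hc
    rw [← g.span_eq, Submodule.mem_ideal_smul_span_iff_exists_sum] at hmem
    obtain ⟨a, ha, hae⟩ := hmem
    intro i
    have hai : a i = e i := by
      have := congrArg (fun x => g.repr x i) hae
      rw [← Finsupp.linearCombination_apply, g.repr_linearCombination] at this
      rwa [g.repr_sum_self] at this
    rw [← he i, ← hai]
    exact ha i
  · rintro b -
    obtain ⟨a, rfl⟩ := hq b
    rw [← g.sum_repr a, hsum]
    exact Submodule.sum_mem _ fun i _ => Submodule.smul_mem _ _ (Submodule.subset_span ⟨i, rfl⟩)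

/-- The specialization `K[Z₁, …, Z_m] → K[Z_{j+1}, …, Z_m]` sending `Z_i` to `p_i` for `i ≤ j`. -/
def specializeVars {K : Type*} [Field K] {m : ℕ} (j : ℕ) (p : Fin m → K) :
    MvPolynomial (Fin m) K →ₐ[K] MvPolynomial (Fin (m - j)) K :=
  aeval fun i => if h : (i : ℕ) < j then C (p i) else X ⟨(i : ℕ) - j, by have := i.2; omega⟩

theorem specializeVars_surjective {K : Type*} [Field K] {m j : ℕ} (p : Fin m → K) :
    Function.Surjective (specializeVars j p) := by
  have h : (specializeVars j p).comp
      (rename fun i : Fin (m - j) => (⟨j + i, by have := i.2; omega⟩ : Fin m)) =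
      AlgHom.id K _ := by
    ext1 i
    simp [specializeVars]
  exact fun f => ⟨_, congrArg (fun e => e f) h⟩

theorem eval_specializeVars {K : Type*} [Field K] {m j : ℕ} (p : Fin m → K)
    (f : MvPolynomial (Fin m) K) :
    eval (fun i : Fin (m - j) => p ⟨j + i, by have := i.2; omega⟩) (specializeVars j p f) =
      eval p f := by
  have h : (aeval fun i : Fin (m - j) => p ⟨j + i, by have := i.2; omega⟩).comp
      (specializeVars j p) = aeval p := by
    ext i
    by_cases hi : (i : ℕ) < j
    · simp [specializeVars, hi]
    · have : j + ((i : ℕ) - j) = i := by omega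
      simp [specializeVars, hi, this]
  simpa [aeval_eq_eval] using congrArg (fun e => e f) h

theorem coordMap_specializeVars {K : Type*} [Field K] {n m j : ℕ} (hj : j ≤ m)
    {I J : Ideal (MvPolynomial (Fin n) K)} (hIJ : I ≤ J) (Y : Fin m → MvPolynomial (Fin n) K)
    (p : Fin m → K)
    (hJ : ∀ i : Fin j, Y (Fin.castLE hj i) - C (p (Fin.castLE hj i)) ∈ J)
    (f : MvPolynomial (Fin m) K) :
    coordMap J (fun i : Fin (m - j) => Y ⟨j + i, by have := i.2; omega⟩) (specializeVars j p f) =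
      Ideal.Quotient.factor hIJ (coordMap I Y f) := by
  have h : (coordMap J fun i : Fin (m - j) => Y ⟨j + i, by have := i.2; omega⟩).comp
      (specializeVars j p) = (Ideal.Quotient.factorₐ K hIJ).comp (coordMap I Y) := by
    ext i
    by_cases hi : (i : ℕ) < j
    · have := Ideal.Quotient.eq.mpr (hJ ⟨i, hi⟩)
      simp only [AlgHom.comp_apply, coordMap, specializeVars, aeval_X, hi, dif_pos, algHom_C]
      exact this.symm
    · have : j + ((i : ℕ) - j) = i := by omega
      simp [coordMap, specializeVars, hi, this]
  exact congrArg (fun e => e f) h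

theorem exists_basis_of_isFreeBasisOver {K : Type*} [Field K] {n m D : ℕ}
    {I : Ideal (MvPolynomial (Fin n) K)} {Y : Fin m → MvPolynomial (Fin n) K}
    {g : Fin D → MvPolynomial (Fin n) K ⧸ I} (hg : IsFreeBasisOver I Y g) :
    letI := (coordMap I Y).toRingHom.toAlgebra
    letI : Module (MvPolynomial (Fin m) K) (MvPolynomial (Fin n) K ⧸ I) := Algebra.toModule
    Nonempty (Module.Basis (Fin D) (MvPolynomial (Fin m) K) (MvPolynomial (Fin n) K ⧸ I)) := by
  let _ := (coordMap I Y).toRingHom.toAlgebra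
  let _ : Module (MvPolynomial (Fin m) K) (MvPolynomial (Fin n) K ⧸ I) := Algebra.toModule
  refine ⟨Module.Basis.mk (v := g) ?_ ?_⟩
  · rw [Fintype.linearIndependent_iff]
    exact hg.2
  · rintro b -
    obtain ⟨c, rfl⟩ := hg.1 b
    exact Submodule.sum_mem _ fun i _ =>
      Submodule.smul_mem _ (c i) (Submodule.subset_span ⟨i, rfl⟩)

theorem exists_basis_specialization {K : Type*} [Field K] {n m D j : ℕ} (hj : j ≤ m)
    (I : Ideal (MvPolynomial (Fin n) K)) (Y : Fin m → MvPolynomial (Fin n) K) (p : Fin m → K)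
    {g : Fin D → MvPolynomial (Fin n) K ⧸ I} (hg : IsFreeBasisOver I Y g)
    {J : Ideal (MvPolynomial (Fin n) K)}
    (hJ : J = I ⊔ Ideal.span (Set.range fun i : Fin j =>
      Y (Fin.castLE hj i) - C (p (Fin.castLE hj i)))) :
    letI := (coordMap J fun i : Fin (m - j) => Y ⟨j + i, by have := i.2; omega⟩).toRingHom.toAlgebra
    letI : Module (MvPolynomial (Fin (m - j)) K) (MvPolynomial (Fin n) K ⧸ J) := Algebra.toModule
    Nonempty (Module.Basis (Fin D) (MvPolynomial (Fin (m - j)) K)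
      (MvPolynomial (Fin n) K ⧸ J)) := by
  let _ := (coordMap I Y).toRingHom.toAlgebra
  let _ : Module (MvPolynomial (Fin m) K) (MvPolynomial (Fin n) K ⧸ I) := Algebra.toModule
  let _ := (coordMap J fun i : Fin (m - j) => Y ⟨j + i, by have := i.2; omega⟩).toRingHom.toAlgebra
  let _ : Module (MvPolynomial (Fin (m - j)) K) (MvPolynomial (Fin n) K ⧸ J) := Algebra.toModule
  obtain ⟨b⟩ := exists_basis_of_isFreeBasisOver hg
  have hIJ : I ≤ J := hJ ▸ le_sup_left
  refine exists_basis_of_ker_le_map b (specializeVars j p).toRingHom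
    (specializeVars_surjective p) (Ideal.Quotient.factor hIJ)
    (Ideal.Quotient.factor_surjective hIJ)
    (coordMap_specializeVars hj hIJ Y p fun i =>
      hJ ▸ Ideal.mem_sup_right (Ideal.subset_span ⟨i, rfl⟩)) ?_
  rw [Ideal.Quotient.factor_ker, hJ, Ideal.map_sup, Ideal.map_quotient_self, bot_sup_eq,
    Ideal.map_span, Ideal.span_le]
  rintro _ ⟨_, ⟨i, rfl⟩, rfl⟩
  have hmem : X (Fin.castLE hj i) - C (p (Fin.castLE hj i)) ∈
      RingHom.ker (specializeVars j p).toRingHom := by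
    simp [RingHom.mem_ker, specializeVars]
  have hgen : Ideal.Quotient.mk I (Y (Fin.castLE hj i) - C (p (Fin.castLE hj i))) =
      coordMap I Y (X (Fin.castLE hj i) - C (p (Fin.castLE hj i))) := by
    simp [coordMap]
    rfl
  rw [SetLike.mem_coe, hgen]
  exact Ideal.mem_map_of_mem (algebraMap _ (MvPolynomial (Fin n) K ⧸ I)) hmem

theorem span_jacobian_sup_map_ker_eval_eq_top {K : Type*} [Field K] {n s j : ℕ} (hsn : s ≤ n)
    (hj : j ≤ n - s) (F : Fin s → MvPolynomial (Fin n) K)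
    (Y : Fin (n - s) → MvPolynomial (Fin n) K) (p : Fin (n - s) → K)
    (hp : IsLiftingPoint n s hsn (mvZeroSet (Set.range F)) Y F p)
    {J : Ideal (MvPolynomial (Fin n) K)} (hFJ : ∀ i, F i ∈ J)
    (hYJ : ∀ i : Fin j, Y (Fin.castLE hj i) - C (p (Fin.castLE hj i)) ∈ J) :
    Ideal.span {Ideal.Quotient.mk J (jacMat n s hsn Y F).det} ⊔
      (RingHom.ker (eval fun i : Fin (n - s - j) => p ⟨j + i, by have := i.2; omega⟩)).map
        (coordMap J fun i : Fin (n - s - j) => Y ⟨j + i, by have := i.2; omega⟩).toRingHom = ⊤ := by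
  by_contra hne
  obtain ⟨x, hx⟩ := exists_aeval_eq_zero_of_ne_top
    (Ideal.comap_ne_top (Ideal.Quotient.mk J) hne)
  refine hp x ⟨?_, fun i => ?_⟩ (hx _ (Ideal.mem_sup_left (Ideal.mem_span_singleton_self _)))
  · rintro _ ⟨i, rfl⟩
    refine hx _ ?_
    rw [Ideal.mem_comap, Ideal.Quotient.eq_zero_iff_mem.mpr (hFJ i)]
    exact zero_mem _
  · have h := hx (Y i - C (p i)) (Ideal.mem_sup_right ?_)
    · simpa [sub_eq_zero] using h
    · have h1 := coordMap_specializeVars hj le_rfl Y p hYJ (X i - C (p i))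
      have h2 : Ideal.Quotient.factor le_rfl (coordMap J Y (X i - C (p i))) =
          Ideal.Quotient.mk J (Y i - C (p i)) := by
        simp [coordMap]; rfl
      rw [← h2, ← h1]
      refine Ideal.mem_map_of_mem
        (coordMap J fun i : Fin (n - s - j) => Y ⟨j + i, by have := i.2; omega⟩).toRingHom ?_
      rw [RingHom.mem_ker, eval_specializeVars]
      simp

theorem jacobian_smul_kaehlerDifferential_eq_zero {K : Type*} [Field K] {n s j : ℕ} (hsn : s ≤ n)
    (hj : j ≤ n - s) (F : Fin s → MvPolynomial (Fin n) K)
    (Y : Fin (n - s) → MvPolynomial (Fin n) K) (p : Fin (n - s) → K)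
    {J : Ideal (MvPolynomial (Fin n) K)} (hFJ : ∀ i, F i ∈ J)
    (hYJ : ∀ i : Fin j, Y (Fin.castLE hj i) - C (p (Fin.castLE hj i)) ∈ J)
    [Algebra (MvPolynomial (Fin (n - s - j)) K) (MvPolynomial (Fin n) K ⧸ J)]
    (halg : algebraMap (MvPolynomial (Fin (n - s - j)) K) (MvPolynomial (Fin n) K ⧸ J) =
      (coordMap J fun i : Fin (n - s - j) => Y ⟨j + i, by have := i.2; omega⟩).toRingHom)
    (ω : Ω[(MvPolynomial (Fin n) K ⧸ J)⁄MvPolynomial (Fin (n - s - j)) K]) :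
    Ideal.Quotient.mk J (jacMat n s hsn Y F).det • ω = 0 := by
  let G : Fin n → MvPolynomial (Fin n) K := fun i =>
    if h : (i : ℕ) < n - s then Y ⟨i, h⟩ else F ⟨(i : ℕ) - (n - s), by have := i.2; omega⟩
  have hjac : jacMat n s hsn Y F = Matrix.of fun i k => pderiv k (G i) := by
    ext1 i k
    by_cases h : (i : ℕ) < n - s <;> simp [jacMat, G, h]
  let _ : Module (MvPolynomial (Fin (n - s - j)) K) (MvPolynomial (Fin n) K ⧸ J) :=
    Algebra.toModule
  have : IsScalarTower K (MvPolynomial (Fin (n - s - j)) K) (MvPolynomial (Fin n) K ⧸ J) :=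
    IsScalarTower.of_algebraMap_eq' (by rw [halg]; exact (coordMap J _).comp_algebraMap.symm)
  rw [hjac]
  refine det_pderiv_smul_kaehlerDifferential_eq_zero (K := K)
    (B := MvPolynomial (Fin n) K ⧸ J) Ideal.Quotient.mk_surjective G (fun i => ?_) ω
  change KaehlerDifferential.D _ _ (Ideal.Quotient.mk J (G i)) = 0
  by_cases h : (i : ℕ) < n - s
  · have h1 := coordMap_specializeVars hj le_rfl Y p hYJ (X ⟨i, h⟩)
    have h2 : Ideal.Quotient.factor le_rfl (coordMap J Y (X ⟨i, h⟩)) =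
        Ideal.Quotient.mk J (G i) := by
      simp [coordMap, G, h]
    rw [← h2, ← h1]
    have h3 := RingHom.congr_fun halg (specializeVars j p (X ⟨i, h⟩))
    exact (congrArg _ h3.symm).trans (Derivation.map_algebraMap _ _)
  · have h2 : Ideal.Quotient.mk J (G i) = 0 := by
      simpa [G, h] using Ideal.Quotient.eq_zero_iff_mem.mpr (hFJ _)
    rw [h2, map_zero]

theorem isRadical_of_isLiftingPoint {K : Type*} [Field K] {n s j : ℕ} (hsn : s ≤ n)
    (hj : j ≤ n - s) (F : Fin s → MvPolynomial (Fin n) K)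
    (Y : Fin (n - s) → MvPolynomial (Fin n) K) (p : Fin (n - s) → K)
    (hp : IsLiftingPoint n s hsn (mvZeroSet (Set.range F)) Y F p)
    {J : Ideal (MvPolynomial (Fin n) K)} (hFJ : ∀ i, F i ∈ J)
    (hYJ : ∀ i : Fin j, Y (Fin.castLE hj i) - C (p (Fin.castLE hj i)) ∈ J)
    [Algebra (MvPolynomial (Fin (n - s - j)) K) (MvPolynomial (Fin n) K ⧸ J)]
    (halg : algebraMap (MvPolynomial (Fin (n - s - j)) K) (MvPolynomial (Fin n) K ⧸ J) =
      (coordMap J fun i : Fin (n - s - j) => Y ⟨j + i, by have := i.2; omega⟩).toRingHom)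
    (hfin : @Module.Finite (MvPolynomial (Fin (n - s - j)) K) (MvPolynomial (Fin n) K ⧸ J) _ _
      Algebra.toModule)
    (hfree : @Module.Free (MvPolynomial (Fin (n - s - j)) K) (MvPolynomial (Fin n) K ⧸ J) _ _
      Algebra.toModule) :
    J.IsRadical := by
  have htop := span_jacobian_sup_map_ker_eval_eq_top hsn hj F Y p hp hFJ hYJ
  rw [← halg] at htop
  obtain ⟨r, hr, hrd⟩ := exists_sub_one_mem_and_algebraMap_mem_span_singleton htop
  have hr0 : r ≠ 0 := by
    rintro rfl
    simp [RingHom.mem_ker] at hr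
  rw [Ideal.isRadical_iff_quotient_reduced]
  exact isReduced_of_smul_kaehlerDifferential_eq_zero hr0 hrd
    (jacobian_smul_kaehlerDifferential_eq_zero hsn hj F Y p hFJ hYJ halg)

/-- Lemma 4.2 of the paper. -/
theorem stmt_5 {K : Type*} [Field K] [PerfectField K] (n s D j : ℕ)
    (hsn : s ≤ n) (hj : j ≤ n - s)
    (V : Set (Fin n → AlgebraicClosure K))
    (F : Fin s → MvPolynomial (Fin n) K)
    (hV : V = mvZeroSet (Set.range F))
    (hIV : mvVanishingIdeal V = Ideal.span (Set.range F))
    (hequi : ∀ P ∈ (mvVanishingIdeal V).minimalPrimes,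
      ringKrullDim (MvPolynomial (Fin n) K ⧸ P) = ((n - s : ℕ) : WithBot ℕ∞))
    (Y : Fin n → MvPolynomial (Fin n) K)
    (hYhom : ∀ i, (Y i).IsHomogeneous 1)
    (hYind : LinearIndependent K Y)
    -- `π : V → K̄^{n−s}` defined by `Y₁, …, Y_{n−s}` is a finite morphism
    (hfin : Function.Injective (coordMap (mvVanishingIdeal V)
        (fun i : Fin (n - s) => Y ⟨(i : ℕ), by have := i.2; omega⟩)) ∧
      RingHom.IsIntegral (coordMap (mvVanishingIdeal V)
        (fun i : Fin (n - s) => Y ⟨(i : ℕ), by have := i.2; omega⟩)).toRingHom)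
    -- `K[V]` is a free `R`-module of finite rank `D`
    (hfree : ∃ g : Fin D → MvPolynomial (Fin n) K ⧸ mvVanishingIdeal V,
      IsFreeBasisOver (mvVanishingIdeal V)
        (fun i : Fin (n - s) => Y ⟨(i : ℕ), by have := i.2; omega⟩) g)
    -- `p` is a lifting point of `π`
    (p : Fin (n - s) → K)
    (hp : IsLiftingPoint n s hsn V
      (fun i : Fin (n - s) => Y ⟨(i : ℕ), by have := i.2; omega⟩) F p) :
    let Jj : Ideal (MvPolynomial (Fin n) K) :=
      Ideal.span (Set.range F) ⊔ Ideal.span (Set.range fun i : Fin j =>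
        Y ⟨(i : ℕ), by have := i.2; omega⟩ -
          MvPolynomial.C (p ⟨(i : ℕ), by have := i.2; omega⟩));
    -- `𝒥_j` is radical, equidimensional of dimension `n − s − j`, and
    -- `Y_{j+1}, …, Y_{n−s}` define a finite morphism on its zero set
    Jj.IsRadical ∧
    (∀ P ∈ Jj.minimalPrimes,
      ringKrullDim (MvPolynomial (Fin n) K ⧸ P) = ((n - s - j : ℕ) : WithBot ℕ∞)) ∧
    Function.Injective (coordMap Jj
      (fun i : Fin (n - s - j) => Y ⟨j + (i : ℕ), by have := i.2; omega⟩)) ∧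
    RingHom.IsIntegral (coordMap Jj
      (fun i : Fin (n - s - j) => Y ⟨j + (i : ℕ), by have := i.2; omega⟩)).toRingHom := by
  intro Jj
  set Y' : Fin (n - s) → MvPolynomial (Fin n) K :=
    fun i => Y ⟨(i : ℕ), by have := i.2; omega⟩
  obtain ⟨g, hg⟩ := hfree
  have hJj : Jj = mvVanishingIdeal V ⊔ Ideal.span (Set.range fun i : Fin j =>
      Y' (Fin.castLE hj i) - C (p (Fin.castLE hj i))) := by
    rw [hIV]; rfl
  have hFJ : ∀ i, F i ∈ Jj := fun i => Ideal.mem_sup_left (Ideal.subset_span ⟨i, rfl⟩)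
  have hYJ : ∀ i : Fin j, Y' (Fin.castLE hj i) - C (p (Fin.castLE hj i)) ∈ Jj :=
    fun i => Ideal.mem_sup_right (Ideal.subset_span ⟨i, rfl⟩)
  have hD : Nonempty (Fin D) := by
    by_contra hempty
    rw [not_nonempty_iff] at hempty
    have h1 : (1 : MvPolynomial (Fin n) K ⧸ mvVanishingIdeal V) = 0 := by
      obtain ⟨c, hc⟩ := hg.1 1
      simpa using hc
    exact one_ne_zero (hfin.1 (by rw [map_one, map_zero, h1]))
  let φ := coordMap Jj fun i : Fin (n - s - j) => Y' ⟨j + i, by have := i.2; omega⟩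
  change _ ∧ _ ∧ Function.Injective φ ∧ φ.toRingHom.IsIntegral
  let _ := φ.toRingHom.toAlgebra
  let _ : Module (MvPolynomial (Fin (n - s - j)) K) (MvPolynomial (Fin n) K ⧸ Jj) :=
    Algebra.toModule
  obtain ⟨b⟩ := exists_basis_specialization hj _ Y' p hg hJj
  have : Module.Finite (MvPolynomial (Fin (n - s - j)) K) (MvPolynomial (Fin n) K ⧸ Jj) :=
    .of_basis b
  have : Module.Free (MvPolynomial (Fin (n - s - j)) K) (MvPolynomial (Fin n) K ⧸ Jj) :=
    .of_basis b
  have : Nontrivial (MvPolynomial (Fin n) K ⧸ Jj) := ⟨_, _, b.ne_zero hD.some⟩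
  have hint : φ.toRingHom.IsIntegral :=
    (algebraMap_isIntegral_iff (R := MvPolynomial (Fin (n - s - j)) K)).mpr inferInstance
  have hreg : ∀ r ≠ 0, φ.toRingHom r ∈ nonZeroDivisors (MvPolynomial (Fin n) K ⧸ Jj) := by
    intro r hr
    rw [mem_nonZeroDivisors_iff_right]
    intro a ha
    rw [mul_comm] at ha
    exact (smul_eq_zero.mp (show r • a = 0 from ha)).resolve_left hr
  refine ⟨?_, fun P hP => ?_, ?_, hint⟩
  · rw [hV] at hp
    exact isRadical_of_isLiftingPoint hsn hj F Y' p hp hFJ hYJ rfl inferInstance inferInstance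
  · rw [ringKrullDim_quotient_of_mem_minimalPrimes φ.toRingHom hint hreg hP,
      MvPolynomial.ringKrullDim_of_isNoetherianRing, ringKrullDim_eq_zero_of_field]
    simp
  · exact FaithfulSMul.algebraMap_injective (MvPolynomial (Fin (n - s - j)) K)
      (MvPolynomial (Fin n) K ⧸ Jj)
end
end

section
/- Let K be a perfect field, V ⊆ K̄^n an equidimensional K-variety of dimension n − s with I(V) = (F_1, ..., F_s), Y_1, ..., Y_n ∈ K[X_1, ..., X_n] linearly independent linear forms such that π : V → K̄^{n−s} defined by Y_1, ..., Y_{n−s} is a finite morphism, R := K[Y_1, ..., Y_{n−s}], K[V] a free R-module of finite rank D, and p = (p_1, ..., p_{n−s}) ∈ K^{n−s} a lifting point of π. For 1 ≤ i ≤ s, let G_i ∈ K[Y_{n−s+1}, ..., Y_n] be obtained from F_i by rewriting F_i in the coordinates Y_1, ..., Y_n and substituting p_k for Y_k for 1 ≤ k ≤ n − s. Then G_1, ..., G_s generate a radical zero-dimensional ideal of K[Y_{n−s+1}, ..., Y_n], the quotient K[Y_{n−s+1}, ..., Y_n]/(G_1, ..., G_s) is a K-vector space of dimension D, and the zero set of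 (G_1, ..., G_s) in K̄^s is isomorphic (as a variety) to the fiber π^{−1}(p). -/
open MvPolynomial

noncomputable section

/-- Substitution of the values `p₁, …, p_{n−s}` for the first `n − s` variables of a
polynomial in `n` variables, yielding a polynomial in the last `s` variables. -/
def substFirst {K : Type*} [Field K] (n s : ℕ) (hsn : s ≤ n) (p : Fin (n - s) → K)
    (f : MvPolynomial (Fin n) K) : MvPolynomial (Fin s) K :=
  MvPolynomial.aeval (fun j : Fin n =>
    if h : (j : ℕ) < n - s then MvPolynomial.C (p ⟨(j : ℕ), h⟩)
    else MvPolynomial.X ⟨(j : ℕ) - (n - s), by have := j.2; omega⟩) f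

namespace MvPolynomial

/-- A derivation on a polynomial ring is determined by the partial derivatives. -/
lemma derivation_eq_sum_pderiv {R σ M : Type*} [CommRing R] [Fintype σ] [AddCommGroup M]
    [Module R M] [Module (MvPolynomial σ R) M] [IsScalarTower R (MvPolynomial σ R) M]
    (d : Derivation R (MvPolynomial σ R) M) (f : MvPolynomial σ R) :
    d f = ∑ j, pderiv j f • d (X j) := by
  classical
  let e : Derivation R (MvPolynomial σ R) M :=
    ∑ j, (LinearMap.toSpanSingleton (MvPolynomial σ R) M (d (X j))).compDer (pderiv j)
  have he : ∀ g, e g = ∑ j, pderiv j g • d (X j) := fun g => by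
    have := congrFun (map_sum Derivation.coeFnAddMonoidHom (fun j =>
      (LinearMap.toSpanSingleton (MvPolynomial σ R) M (d (X j))).compDer (pderiv j))
      Finset.univ) g
    rw [Finset.sum_apply] at this
    exact this
  have hde : d = e := by
    refine derivation_ext fun i => ?_
    rw [he, Finset.sum_eq_single i]
    · simp
    · intro j _ hj
      simp [pderiv_X_of_ne hj.symm]
    · simp
  rw [← he, ← hde]

/-- The Jacobian criterion: a quotient of a polynomial ring over a field by an ideal containing
as many polynomials as there are variables is reduced, as soon as their Jacobian determinant is
invertible in the quotient. -/
lemma isReduced_quotient_of_isUnit_jacobian {K σ : Type*} [Field K] [Fintype σ] [DecidableEq σ]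
    (I : Ideal (MvPolynomial σ K)) (f : σ → MvPolynomial σ K) (hf : ∀ i, f i ∈ I)
    (hdet : IsUnit (Ideal.Quotient.mk I (Matrix.of fun i j => pderiv j (f i)).det)) :
    IsReduced (MvPolynomial σ K ⧸ I) := by
  set M : Matrix σ σ (MvPolynomial σ K) := Matrix.of fun i j => pderiv j (f i)
  let d := (KaehlerDifferential.D K (MvPolynomial σ K ⧸ I)).compAlgebraMap (MvPolynomial σ K)
  have hd : ∀ g, d g = KaehlerDifferential.D K _ (Ideal.Quotient.mk I g) := fun g => rfl
  have hrow : ∀ i, ∑ j, M i j • d (X j) = 0 := fun i => by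
    refine (derivation_eq_sum_pderiv d (f i)).symm.trans ?_
    rw [hd, Ideal.Quotient.eq_zero_iff_mem.2 (hf i), map_zero]
  have hX : ∀ k, d (X k) = 0 := fun k => by
    have h : M.det • d (X k) = 0 := by
      calc M.det • d (X k) = ∑ j, (M.adjugate * M) k j • d (X j) := by
            rw [Matrix.adjugate_mul, Finset.sum_eq_single k]
            · simp
            · intro j _ hj
              simp [Matrix.one_apply_ne hj.symm]
            · simp
        _ = ∑ i, M.adjugate k i • ∑ j, M i j • d (X j) := by
            simp only [Matrix.mul_apply, Finset.sum_smul, Finset.smul_sum, mul_smul]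
            exact Finset.sum_comm
        _ = 0 := by simp [hrow]
    rw [← algebraMap_smul (MvPolynomial σ K ⧸ I)] at h
    exact hdet.smul_eq_zero.1 h
  have hzero : ∀ g, d g = 0 := fun g => by
    rw [derivation_eq_sum_pderiv]
    simp [hX]
  have : Algebra.FormallyUnramified K (MvPolynomial σ K ⧸ I) := by
    refine ⟨(Submodule.subsingleton_iff (MvPolynomial σ K ⧸ I)).1
      (subsingleton_of_bot_eq_top ?_)⟩
    rw [← KaehlerDifferential.span_range_derivation, eq_comm, Submodule.span_eq_bot]
    rintro _ ⟨q, rfl⟩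
    obtain ⟨g, rfl⟩ := Ideal.Quotient.mk_surjective q
    exact hzero g
  exact Algebra.FormallyUnramified.isReduced_of_field K _

/-- A polynomial without zeros on the zero locus of an ideal is invertible modulo this ideal. -/
lemma isUnit_quotient_mk_of_forall_aeval_ne_zero {K L σ : Type*} [Field K] [Field L] [IsAlgClosed L]
    [Algebra K L] [Finite σ] (I : Ideal (MvPolynomial σ K))
    (f : MvPolynomial σ K) (hf : ∀ x ∈ zeroLocus L I, aeval x f ≠ 0) :
    IsUnit (Ideal.Quotient.mk I f) := by
  have hempty : zeroLocus L (I ⊔ Ideal.span {f}) = ∅ := by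
    refine Set.eq_empty_of_forall_notMem fun x hx => ?_
    exact hf x (fun g hg => hx g (Ideal.mem_sup_left hg))
      (hx f (Ideal.mem_sup_right (Ideal.mem_span_singleton_self f)))
  have htop : I ⊔ Ideal.span {f} = ⊤ := by
    rw [← Ideal.radical_eq_top, ← vanishingIdeal_zeroLocus_eq_radical (K := L), hempty,
      vanishingIdeal_empty]
  obtain ⟨a, ha, b, hb, hab⟩ := Submodule.mem_sup.1 ((Ideal.eq_top_iff_one _).1 htop)
  obtain ⟨c, rfl⟩ := Ideal.mem_span_singleton'.1 hb
  refine IsUnit.of_mul_eq_one (Ideal.Quotient.mk I c) ?_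
  rw [mul_comm, ← map_mul, ← map_one (Ideal.Quotient.mk I), ← hab, map_add,
    Ideal.Quotient.eq_zero_iff_mem.2 ha, zero_add]

/-- Linearly independent linear forms, as many as there are variables, form a system of
coordinates of the polynomial ring. -/
lemma bijective_aeval_of_linearIndependent {K : Type*} [Field K] {n : ℕ}
    (Y : Fin n → MvPolynomial (Fin n) K) (hYhom : ∀ i, (Y i).IsHomogeneous 1)
    (hYind : LinearIndependent K Y) :
    Function.Bijective (aeval Y : MvPolynomial (Fin n) K →ₐ[K] MvPolynomial (Fin n) K) := by
  have hle : Submodule.span K (Set.range Y) ≤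
      Submodule.span K (Set.range (X : Fin n → MvPolynomial (Fin n) K)) := by
    rw [Submodule.span_le, ← homogeneousSubmodule_one_eq_span_X]
    rintro _ ⟨i, rfl⟩
    exact hYhom i
  have hspan : Submodule.span K (Set.range Y) =
      Submodule.span K (Set.range (X : Fin n → MvPolynomial (Fin n) K)) := by
    have := FiniteDimensional.span_of_finite K
      (Set.finite_range (X : Fin n → MvPolynomial (Fin n) K))
    refine Submodule.eq_of_le_of_finrank_eq hle ?_
    rw [finrank_span_eq_card hYind, finrank_span_eq_card (linearIndependent_X (Fin n) K)]
  have hlin : ∀ k, ∃ a : Fin n → K, ∑ j, a j • Y j = X k := fun k =>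
    (Submodule.mem_span_range_iff_exists_fun K).1
      (hspan ▸ Submodule.subset_span ⟨k, rfl⟩)
  choose a ha using hlin
  let θ : MvPolynomial (Fin n) K →ₐ[K] MvPolynomial (Fin n) K :=
    aeval fun k => ∑ j, a k j • X j
  have hright : ∀ f, aeval Y (θ f) = f := fun f => by
    have : (aeval Y : MvPolynomial (Fin n) K →ₐ[K] _).comp θ = AlgHom.id K _ := by
      ext1 k
      simp [θ, ha]
    exact DFunLike.congr_fun this f
  have hθY : ∀ j, θ (Y j) = X j := fun j => by
    have hhom : (θ (Y j) - X j).IsHomogeneous 1 := by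
      refine .sub ?_ (isHomogeneous_X K j)
      have := (hYhom j).aeval (fun k => ∑ i, a k i • (X i : MvPolynomial (Fin n) K))
        (n := 1) fun k => .sum _ _ _ fun i _ => by
          rw [smul_eq_C_mul]
          exact (isHomogeneous_X K i).C_mul _
      rwa [one_mul] at this
    rw [← mem_homogeneousSubmodule, homogeneousSubmodule_one_eq_span_X,
      Submodule.mem_span_range_iff_exists_fun] at hhom
    obtain ⟨c, hc⟩ := hhom
    have hsum : ∑ i, c i • Y i = 0 := by
      have := congrArg (aeval Y) hc
      rw [map_sub, hright, aeval_X, sub_self] at this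
      simpa using this
    have hc0 := Fintype.linearIndependent_iff.1 hYind c hsum
    simp only [hc0, zero_smul, Finset.sum_const_zero] at hc
    exact (sub_eq_zero.1 hc.symm)
  have hleft : ∀ f, θ (aeval Y f) = f := fun f => by
    have : θ.comp (aeval Y) = AlgHom.id K _ := by
      ext1 k
      simp [hθY]
    exact DFunLike.congr_fun this f
  exact Function.bijective_iff_has_inverse.2 ⟨θ, hleft, hright⟩

end MvPolynomial

lemma val_lt_of_fin_sub {n s : ℕ} (hsn : s ≤ n) (i : Fin (n - s)) : (i : ℕ) < n := by
  omega

lemma sub_add_val_lt {n s : ℕ} (hsn : s ≤ n) (i : Fin s) : n - s + (i : ℕ) < n := by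
  omega

/-- The ideal of the scheme-theoretic fiber over `p` of the morphism given by `Y` on the closed
subscheme defined by `I`. -/
def fiberIdeal {K : Type*} [Field K] {n m : ℕ} (I : Ideal (MvPolynomial (Fin n) K))
    (Y : Fin m → MvPolynomial (Fin n) K) (p : Fin m → K) : Ideal (MvPolynomial (Fin n) K) :=
  I ⊔ Ideal.span (Set.range fun k => Y k - C (p k))

section FiberIdeal

variable {K : Type*} [Field K] {n m : ℕ} (I : Ideal (MvPolynomial (Fin n) K))
  (Y : Fin m → MvPolynomial (Fin n) K) (p : Fin m → K)

lemma le_fiberIdeal : I ≤ fiberIdeal I Y p := le_sup_left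

lemma sub_C_mem_fiberIdeal (k : Fin m) : Y k - C (p k) ∈ fiberIdeal I Y p :=
  Ideal.mem_sup_right (Ideal.subset_span ⟨k, rfl⟩)

lemma quotient_mk_fiberIdeal_apply (k : Fin m) :
    Ideal.Quotient.mk (fiberIdeal I Y p) (Y k) = algebraMap K _ (p k) :=
  Ideal.Quotient.eq.2 (sub_C_mem_fiberIdeal I Y p k)

lemma factorₐ_coordMap (c : MvPolynomial (Fin m) K) :
    Ideal.Quotient.factorₐ K (le_fiberIdeal I Y p) (coordMap I Y c) =
      algebraMap K _ (eval p c) := by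
  have h : (Ideal.Quotient.factorₐ K (le_fiberIdeal I Y p)).comp (coordMap I Y) =
      (Algebra.ofId K _).comp (aeval p) := by
    ext1 k
    simpa [coordMap, Algebra.ofId_apply] using quotient_mk_fiberIdeal_apply I Y p k
  simpa [Algebra.ofId_apply] using DFunLike.congr_fun h c

/-- Every element of the ideal of the fiber over `p` has a representation in terms of a generating
family whose coefficients vanish at `p`. -/
lemma exists_eq_sum_of_mem_fiberIdeal {D : ℕ} (g : Fin D → MvPolynomial (Fin n) K ⧸ I)
    (hg : ∀ b : MvPolynomial (Fin n) K ⧸ I, ∃ c : Fin D → MvPolynomial (Fin m) K,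
      b = ∑ i, coordMap I Y (c i) * g i)
    (a : MvPolynomial (Fin n) K) (ha : a ∈ fiberIdeal I Y p) :
    ∃ c : Fin D → MvPolynomial (Fin m) K,
      Ideal.Quotient.mk I a = ∑ i, coordMap I Y (c i) * g i ∧ ∀ i, eval p (c i) = 0 := by
  obtain ⟨u, hu, v, hv, rfl⟩ := Submodule.mem_sup.1 ha
  rw [map_add, Ideal.Quotient.eq_zero_iff_mem.2 hu, zero_add]
  clear ha hu u
  induction hv using Submodule.span_induction with
  | mem x hx =>
    obtain ⟨k, rfl⟩ := hx
    obtain ⟨c, hc⟩ := hg 1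
    refine ⟨fun i => (X k - C (p k)) * c i, ?_, fun i => by simp⟩
    have hk : coordMap I Y (X k - C (p k)) = Ideal.Quotient.mk I (Y k - C (p k)) := by
      simp [coordMap, IsScalarTower.algebraMap_apply K (MvPolynomial (Fin n) K)
        (MvPolynomial (Fin n) K ⧸ I), algebraMap_eq]
    simp only [map_mul (coordMap I Y), mul_assoc, ← Finset.mul_sum, ← hc, mul_one]
    exact hk.symm
  | zero => exact ⟨0, by simp, by simp⟩
  | add x y _ _ hx hy =>
    obtain ⟨c, hc, hc0⟩ := hx
    obtain ⟨d, hd, hd0⟩ := hy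
    refine ⟨c + d, ?_, fun i => by simp [hc0, hd0]⟩
    simp [hc, hd, add_mul, Finset.sum_add_distrib]
  | smul r x _ hx =>
    obtain ⟨c, hc, hc0⟩ := hx
    choose d hd using fun i => hg (Ideal.Quotient.mk I r * g i)
    refine ⟨fun j => ∑ i, c i * d i j, ?_, fun j => by simp [hc0]⟩
    calc Ideal.Quotient.mk I (r • x)
        = ∑ i, coordMap I Y (c i) * (Ideal.Quotient.mk I r * g i) := by
          rw [smul_eq_mul, map_mul, hc, Finset.mul_sum]
          exact Finset.sum_congr rfl fun i _ => by ring
      _ = ∑ i, ∑ j, coordMap I Y (c i * d i j) * g j := by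
          refine Finset.sum_congr rfl fun i _ => ?_
          rw [hd, Finset.mul_sum]
          simp only [map_mul, mul_assoc]
      _ = ∑ j, coordMap I Y (∑ i, c i * d i j) * g j := by
          rw [Finset.sum_comm]
          simp only [map_sum, Finset.sum_mul]

/-- A basis of the coordinate ring over `K[Y₁, …, Y_m]` specializes to a `K`-basis of the
coordinate ring of the fiber. -/
lemma nonempty_linearEquiv_quotient_fiberIdeal {D : ℕ} (g : Fin D → MvPolynomial (Fin n) K ⧸ I)
    (hg : IsFreeBasisOver I Y g) :
    Nonempty ((Fin D → K) ≃ₗ[K] (MvPolynomial (Fin n) K ⧸ fiberIdeal I Y p)) := by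
  let q := Ideal.Quotient.factorₐ K (le_fiberIdeal I Y p)
  have hq : ∀ c : Fin D → MvPolynomial (Fin m) K,
      q (∑ i, coordMap I Y (c i) * g i) = ∑ i, eval p (c i) • q (g i) := fun c => by
    simp only [map_sum, map_mul, q, factorₐ_coordMap]
    exact Finset.sum_congr rfl fun i _ => (Algebra.smul_def _ _).symm
  have hL : ∀ c, Fintype.linearCombination K (fun i => q (g i)) c = ∑ i, c i • q (g i) :=
    Fintype.linearCombination_apply K _
  refine ⟨LinearEquiv.ofBijective (Fintype.linearCombination K fun i => q (g i)) ⟨?_, ?_⟩⟩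
  · rw [← LinearMap.ker_eq_bot, LinearMap.ker_eq_bot']
    intro c hc
    have hcq : q (∑ i, coordMap I Y (C (c i)) * g i) = 0 := by
      simpa [hL] using (hq fun i => C (c i)).trans (by simpa [hL] using hc)
    obtain ⟨a, ha⟩ := Ideal.Quotient.mk_surjective (∑ i, coordMap I Y (C (c i)) * g i)
    rw [← ha] at hcq
    obtain ⟨d, hd, hd0⟩ := exists_eq_sum_of_mem_fiberIdeal I Y p g hg.1 a
      (Ideal.Quotient.eq_zero_iff_mem.1 hcq)
    have hzero := hg.2 (fun i => C (c i) - d i) (by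
      simp only [map_sub, sub_mul, Finset.sum_sub_distrib]
      rw [← hd, ha, sub_self])
    ext i
    simpa [hd0] using congrArg (eval p) (hzero i)
  · intro b
    obtain ⟨a, rfl⟩ := Ideal.Quotient.mk_surjective b
    obtain ⟨c, hc⟩ := hg.1 (Ideal.Quotient.mk I a)
    refine ⟨fun i => eval p (c i), ?_⟩
    rw [hL, ← hq, ← hc]
    rfl

end FiberIdeal

/-- Substitution of `p` for the first variables, as an algebra homomorphism. -/
def substFirstHom {K : Type*} [Field K] (n s : ℕ) (hsn : s ≤ n) (p : Fin (n - s) → K) :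
    MvPolynomial (Fin n) K →ₐ[K] MvPolynomial (Fin s) K :=
  aeval fun j : Fin n =>
    if h : (j : ℕ) < n - s then C (p ⟨(j : ℕ), h⟩)
    else X ⟨(j : ℕ) - (n - s), by have := j.2; omega⟩

section Coordinates

variable {K : Type*} [Field K] {n s : ℕ} (hsn : s ≤ n) (p : Fin (n - s) → K)

lemma substFirstHom_apply (f : MvPolynomial (Fin n) K) :
    substFirstHom n s hsn p f = substFirst n s hsn p f := rfl

lemma substFirst_X_of_lt (i : Fin (n - s)) :
    substFirst n s hsn p (X ⟨i, val_lt_of_fin_sub hsn i⟩) = C (p i) := by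
  simp [substFirst]

lemma substFirst_X_add (i : Fin s) :
    substFirst n s hsn p (X ⟨n - s + i, sub_add_val_lt hsn i⟩) = X i := by
  simp [substFirst]

/-- The coordinate ring of the fiber over `p`, in the coordinates `Y_{n-s+1}, …, Yₙ`. -/
lemma nonempty_algEquiv_quotient_substFirst (Y : Fin n → MvPolynomial (Fin n) K)
    (hY : Function.Bijective (aeval Y : MvPolynomial (Fin n) K →ₐ[K] MvPolynomial (Fin n) K))
    {ι : Type*} (F : ι → MvPolynomial (Fin n) K) (Ft : ι → MvPolynomial (Fin n) K)
    (hFt : ∀ i, aeval Y (Ft i) = F i) :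
    Nonempty ((MvPolynomial (Fin n) K ⧸ fiberIdeal (Ideal.span (Set.range F))
        (fun i : Fin (n - s) => Y ⟨(i : ℕ), val_lt_of_fin_sub hsn i⟩) p) ≃ₐ[K]
      (MvPolynomial (Fin s) K ⧸
        Ideal.span (Set.range fun i => substFirst n s hsn p (Ft i)))) := by
  set J := fiberIdeal (Ideal.span (Set.range F))
    (fun i : Fin (n - s) => Y ⟨(i : ℕ), val_lt_of_fin_sub hsn i⟩) p
  set G := Ideal.span (Set.range fun i => substFirst n s hsn p (Ft i))
  let e := AlgEquiv.ofBijective (aeval Y) hY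
  have he : ∀ f, e.symm (aeval Y f) = f := fun f => e.symm_apply_apply f
  have heY : ∀ j, e.symm (Y j) = X j := fun j => by simpa using he (X j)
  let ψ : MvPolynomial (Fin n) K →ₐ[K] MvPolynomial (Fin s) K :=
    (substFirstHom n s hsn p).comp e.symm.toAlgHom
  have hψ : ∀ f, ψ (aeval Y f) = substFirst n s hsn p f := fun f =>
    congrArg (substFirst n s hsn p) (he f)
  have hψY : ∀ j, ψ (Y j) = substFirst n s hsn p (X j) := fun j => by
    simpa using hψ (X j)
  let ε : MvPolynomial (Fin s) K →ₐ[K] MvPolynomial (Fin n) K :=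
    aeval fun i => Y ⟨n - s + i, sub_add_val_lt hsn i⟩
  have hψε : ψ.comp ε = AlgHom.id K _ := by
    ext1 i
    simp [ε, hψY, substFirst_X_add]
  have hεψ : ∀ f, Ideal.Quotient.mk J (ε (ψ f)) = Ideal.Quotient.mk J f := by
    have h : ((Ideal.Quotient.mkₐ K J).comp (ε.comp (substFirstHom n s hsn p))) =
        (Ideal.Quotient.mkₐ K J).comp (aeval Y) := by
      ext1 j
      rcases lt_or_ge (j : ℕ) (n - s) with hj | hj
      · have := substFirst_X_of_lt hsn p ⟨j, hj⟩
        have h2 := quotient_mk_fiberIdeal_apply (Ideal.span (Set.range F))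
          (fun i : Fin (n - s) => Y ⟨(i : ℕ), val_lt_of_fin_sub hsn i⟩) p ⟨j, hj⟩
        simp only [Fin.eta] at this
        simp only [AlgHom.comp_apply, substFirstHom_apply, this, aeval_X]
        rw [← algebraMap_eq, AlgHom.commutes, AlgHom.commutes]
        exact h2.symm
      · have := substFirst_X_add hsn p ⟨j - (n - s), by have := j.2; omega⟩
        simp only [Nat.add_sub_cancel' hj, Fin.eta] at this
        simp only [AlgHom.comp_apply, substFirstHom_apply, this, aeval_X, ε,
          Nat.add_sub_cancel' hj, Fin.eta]
    intro f
    obtain ⟨f, rfl⟩ := hY.2 f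
    rw [hψ]
    exact DFunLike.congr_fun h f
  have hψJ : ∀ f ∈ J, Ideal.Quotient.mkₐ K G (ψ f) = 0 := by
    suffices h : J ≤ RingHom.ker ((Ideal.Quotient.mkₐ K G).comp ψ) from fun f hf => h hf
    refine sup_le (Ideal.span_le.2 ?_) (Ideal.span_le.2 ?_)
    · rintro _ ⟨i, rfl⟩
      refine Ideal.Quotient.eq_zero_iff_mem.2 (Ideal.subset_span ⟨i, ?_⟩)
      simp only [← hFt]
      exact (hψ _).symm
    · rintro _ ⟨k, rfl⟩
      have : ψ (Y ⟨k, val_lt_of_fin_sub hsn k⟩ - C (p k)) = 0 := by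
        rw [map_sub, hψY, substFirst_X_of_lt, ← algebraMap_eq, ← algebraMap_eq, AlgHom.commutes,
          sub_self]
      exact (congrArg (Ideal.Quotient.mk G) this).trans (map_zero _)
  have hεG : ∀ f ∈ G, Ideal.Quotient.mkₐ K J (ε f) = 0 := by
    suffices h : G ≤ RingHom.ker ((Ideal.Quotient.mkₐ K J).comp ε) from fun f hf => h hf
    refine Ideal.span_le.2 ?_
    rintro _ ⟨i, rfl⟩
    change Ideal.Quotient.mk J (ε (substFirst n s hsn p (Ft i))) = 0
    rw [← hψ, hεψ, hFt]
    exact Ideal.Quotient.eq_zero_iff_mem.2 (Ideal.mem_sup_left (Ideal.subset_span ⟨i, rfl⟩))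
  refine ⟨AlgEquiv.ofAlgHom
    (Ideal.Quotient.liftₐ J ((Ideal.Quotient.mkₐ K G).comp ψ) hψJ)
    (Ideal.Quotient.liftₐ G ((Ideal.Quotient.mkₐ K J).comp ε) hεG) ?_ ?_⟩
  · refine Ideal.Quotient.algHom_ext _ (AlgHom.ext fun f => ?_)
    exact congrArg (Ideal.Quotient.mk G) (DFunLike.congr_fun hψε f)
  · exact Ideal.Quotient.algHom_ext _ (AlgHom.ext hεψ)

/-- Evaluation after substitution is evaluation at the extended point. -/
lemma aeval_substFirst {L : Type*} [CommRing L] [Algebra K L] (z : Fin n → L)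
    (hz : ∀ i : Fin (n - s), z ⟨i, val_lt_of_fin_sub hsn i⟩ = algebraMap K L (p i))
    (f : MvPolynomial (Fin n) K) :
    aeval (fun i : Fin s => z ⟨n - s + i, sub_add_val_lt hsn i⟩) (substFirst n s hsn p f) =
      aeval z f := by
  have h : (aeval fun i : Fin s => z ⟨n - s + i, sub_add_val_lt hsn i⟩).comp
      (substFirstHom n s hsn p) = aeval z := by
    ext1 j
    rcases lt_or_ge (j : ℕ) (n - s) with hj | hj
    · simpa [substFirstHom, hj] using (hz ⟨j, hj⟩).symm
    · simp [substFirstHom, hj.not_gt, Nat.add_sub_cancel' hj]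
  exact DFunLike.congr_fun h f

/-- The last coordinates `Y_{n-s+1}, …, Yₙ` identify the fiber over `p` with the common zeros of
the substituted polynomials. -/
lemma bijOn_fiberSet (Y : Fin n → MvPolynomial (Fin n) K)
    (hY : Function.Bijective (aeval Y : MvPolynomial (Fin n) K →ₐ[K] MvPolynomial (Fin n) K))
    {ι : Type*} (F : ι → MvPolynomial (Fin n) K) (Ft : ι → MvPolynomial (Fin n) K)
    (hFt : ∀ i, aeval Y (Ft i) = F i) :
    Set.BijOn
      (fun x (i : Fin s) => aeval x (Y ⟨n - s + (i : ℕ), sub_add_val_lt hsn i⟩))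
      (fiberSet (mvZeroSet (Set.range F))
        (fun i : Fin (n - s) => Y ⟨(i : ℕ), val_lt_of_fin_sub hsn i⟩) p)
      {y : Fin s → AlgebraicClosure K |
        ∀ i, aeval y (substFirst n s hsn p (Ft i)) = 0} := by
  have hcomp : ∀ (x : Fin n → AlgebraicClosure K) (f : MvPolynomial (Fin n) K),
      aeval x (aeval Y f) = aeval (fun j => aeval x (Y j)) f := fun x f => by
    rw [← AlgHom.comp_apply, comp_aeval]
  choose θ hθ using fun k => hY.2 (X k)
  have hθY : ∀ f, aeval θ (aeval Y f) = f := fun f => by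
    apply hY.1
    rw [← AlgHom.comp_apply, comp_aeval]
    simp only [hθ]
    exact aeval_X_left_apply _
  refine ⟨?_, ?_, ?_⟩
  · rintro x ⟨hxV, hxp⟩ i
    change aeval (fun i : Fin s => aeval x (Y _)) _ = 0
    rw [aeval_substFirst hsn p (fun j => aeval x (Y j)) hxp, ← hcomp, hFt]
    exact hxV _ ⟨i, rfl⟩
  · rintro x ⟨-, hxp⟩ x' ⟨-, hxp'⟩ hxx'
    have hall : (fun j => aeval x (Y j)) = fun j => aeval x' (Y j) := by
      funext j
      rcases lt_or_ge (j : ℕ) (n - s) with hj | hj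
      · exact (hxp ⟨j, hj⟩).trans (hxp' ⟨j, hj⟩).symm
      · have := congrFun hxx' ⟨j - (n - s), by have := j.2; omega⟩
        simpa only [Nat.add_sub_cancel' hj, Fin.eta] using this
    funext k
    have hk : ∀ x : Fin n → AlgebraicClosure K, x k = aeval (fun j => aeval x (Y j)) (θ k) :=
      fun x => by rw [← hcomp, hθ, aeval_X]
    rw [hk x, hall, ← hk x']
  · intro y hy
    let z : Fin n → AlgebraicClosure K := fun j =>
      if h : (j : ℕ) < n - s then algebraMap K _ (p ⟨j, h⟩)
      else y ⟨(j : ℕ) - (n - s), by have := j.2; omega⟩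
    have hzp : ∀ i : Fin (n - s), z ⟨i, val_lt_of_fin_sub hsn i⟩ = algebraMap K _ (p i) :=
      fun i => by simp [z]
    have hzy : (fun i : Fin s => z ⟨n - s + i, sub_add_val_lt hsn i⟩) = y := by
      funext i
      simp [z]
    let x : Fin n → AlgebraicClosure K := fun k => aeval z (θ k)
    have hx : ∀ f, aeval x f = aeval z (aeval θ f) := fun f => by
      rw [← AlgHom.comp_apply, comp_aeval]
    have hxY : ∀ j, aeval x (Y j) = z j := fun j => by
      have := hθY (X j)
      rw [aeval_X] at this
      rw [hx, this, aeval_X]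
    refine ⟨x, ⟨?_, fun i => (hxY _).trans (hzp i)⟩, ?_⟩
    · rintro _ ⟨i, rfl⟩
      rw [hx, ← hFt, hθY, ← aeval_substFirst hsn p z hzp, hzy]
      exact hy i
    · simp only [hxY]
      exact hzy

end Coordinates

/-- At a lifting point, the ideal of the fiber is radical. -/
lemma isReduced_quotient_fiberIdeal_of_isLiftingPoint {K : Type*} [Field K] {n s : ℕ} (hsn : s ≤ n)
    (Y : Fin (n - s) → MvPolynomial (Fin n) K) (F : Fin s → MvPolynomial (Fin n) K)
    (p : Fin (n - s) → K)
    (hp : IsLiftingPoint n s hsn (mvZeroSet (Set.range F)) Y F p) :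
    IsReduced (MvPolynomial (Fin n) K ⧸ fiberIdeal (Ideal.span (Set.range F)) Y p) := by
  set J := fiberIdeal (Ideal.span (Set.range F)) Y p
  have hF : ∀ i, F i ∈ J := fun i => Ideal.mem_sup_left (Ideal.subset_span ⟨i, rfl⟩)
  let f : Fin n → MvPolynomial (Fin n) K := fun i =>
    if h : (i : ℕ) < n - s then Y ⟨i, h⟩ - C (p ⟨i, h⟩)
    else F ⟨(i : ℕ) - (n - s), by have h2 := i.2; omega⟩
  have hf : ∀ i, f i ∈ J := fun i => by
    by_cases h : (i : ℕ) < n - s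
    · simpa only [f, dif_pos h] using sub_C_mem_fiberIdeal _ Y p ⟨i, h⟩
    · simpa only [f, dif_neg h] using hF _
  have hjac : (Matrix.of fun i j => pderiv j (f i)) = jacMat n s hsn Y F := by
    ext1 i j
    by_cases h : (i : ℕ) < n - s <;> simp [jacMat, f, h]
  refine isReduced_quotient_of_isUnit_jacobian J f hf ?_
  rw [hjac]
  refine isUnit_quotient_mk_of_forall_aeval_ne_zero (L := AlgebraicClosure K) J _
    fun x hx => hp x ⟨?_, fun k => ?_⟩
  · rintro _ ⟨i, rfl⟩
    exact hx _ (hF i)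
  · have := hx _ (sub_C_mem_fiberIdeal _ Y p k)
    rwa [map_sub, aeval_C, sub_eq_zero] at this

/-- first part of Lemma 4.3 of the paper. -/
theorem stmt_6 {K : Type*} [Field K] [PerfectField K] (n s D : ℕ) (hsn : s ≤ n)
    (V : Set (Fin n → AlgebraicClosure K))
    (F : Fin s → MvPolynomial (Fin n) K)
    (hV : V = mvZeroSet (Set.range F))
    (hIV : mvVanishingIdeal V = Ideal.span (Set.range F))
    (hequi : ∀ P ∈ (mvVanishingIdeal V).minimalPrimes,
      ringKrullDim (MvPolynomial (Fin n) K ⧸ P) = ((n - s : ℕ) : WithBot ℕ∞))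
    (Y : Fin n → MvPolynomial (Fin n) K)
    (hYhom : ∀ i, (Y i).IsHomogeneous 1)
    (hYind : LinearIndependent K Y)
    -- `π : V → K̄^{n−s}` defined by `Y₁, …, Y_{n−s}` is a finite morphism
    (hfin : Function.Injective (coordMap (mvVanishingIdeal V)
        (fun i : Fin (n - s) => Y ⟨(i : ℕ), by have := i.2; omega⟩)) ∧
      RingHom.IsIntegral (coordMap (mvVanishingIdeal V)
        (fun i : Fin (n - s) => Y ⟨(i : ℕ), by have := i.2; omega⟩)).toRingHom)
    -- `K[V]` is a free `R`-module of finite rank `D`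
    (hfree : ∃ g : Fin D → MvPolynomial (Fin n) K ⧸ mvVanishingIdeal V,
      IsFreeBasisOver (mvVanishingIdeal V)
        (fun i : Fin (n - s) => Y ⟨(i : ℕ), by have := i.2; omega⟩) g)
    -- `p` is a lifting point of `π`
    (p : Fin (n - s) → K)
    (hp : IsLiftingPoint n s hsn V
      (fun i : Fin (n - s) => Y ⟨(i : ℕ), by have := i.2; omega⟩) F p)
    -- `Ft i` is `F i` rewritten in the coordinates `Y₁, …, Yₙ`
    (Ft : Fin s → MvPolynomial (Fin n) K)
    (hFt : ∀ i, MvPolynomial.aeval Y (Ft i) = F i) :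
    -- with `G i = F i (p, Y_{n−s+1}, …, Yₙ)`:
    let G : Fin s → MvPolynomial (Fin s) K := fun i => substFirst n s hsn p (Ft i);
    -- `G₁, …, G_s` generate a radical zero-dimensional ideal,
    (Ideal.span (Set.range G)).IsRadical ∧
    ringKrullDim (MvPolynomial (Fin s) K ⧸ Ideal.span (Set.range G)) =
      ((0 : ℕ) : WithBot ℕ∞) ∧
    -- the quotient is a `K`-vector space of dimension `D`,
    FiniteDimensional K (MvPolynomial (Fin s) K ⧸ Ideal.span (Set.range G)) ∧
    Module.finrank K (MvPolynomial (Fin s) K ⧸ Ideal.span (Set.range G)) = D ∧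
    -- and the zero set of `G₁, …, G_s` in `K̄ˢ` is isomorphic to the fiber `π⁻¹(p)`
    Set.BijOn
      (fun x (i : Fin s) =>
        MvPolynomial.aeval x (Y ⟨n - s + (i : ℕ), by have := i.2; omega⟩))
      (fiberSet V (fun i : Fin (n - s) => Y ⟨(i : ℕ), by have := i.2; omega⟩) p)
      {y : Fin s → AlgebraicClosure K | ∀ i, MvPolynomial.aeval y (G i) = 0} := by
  intro G
  subst hV
  have hY := bijective_aeval_of_linearIndependent Y hYhom hYind
  obtain ⟨e⟩ := nonempty_algEquiv_quotient_substFirst hsn p Y hY F Ft hFt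
  have hred := isReduced_quotient_fiberIdeal_of_isLiftingPoint hsn _ F p hp
  have hinj := hfin.1
  rw [hIV] at hfree hinj
  obtain ⟨g, hg⟩ := hfree
  obtain ⟨l⟩ := nonempty_linearEquiv_quotient_fiberIdeal _ _ p g hg
  let b : (Fin D → K) ≃ₗ[K] (MvPolynomial (Fin s) K ⧸ Ideal.span (Set.range G)) :=
    l.trans e.toLinearEquiv
  have hfd : FiniteDimensional K (MvPolynomial (Fin s) K ⧸ Ideal.span (Set.range G)) :=
    Module.Finite.equiv b
  have hrank : Module.finrank K (MvPolynomial (Fin s) K ⧸ Ideal.span (Set.range G)) = D := by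
    rw [← b.finrank_eq, Module.finrank_fin_fun]
  have hD : 0 < D := by
    refine Nat.pos_of_ne_zero ?_
    rintro rfl
    obtain ⟨c, hc⟩ := hg.1 1
    rw [Finset.univ_eq_empty, Finset.sum_empty, ← map_one (coordMap _ _)] at hc
    exact one_ne_zero (hinj (hc.trans (map_zero _).symm))
  have hnt : Nontrivial (MvPolynomial (Fin s) K ⧸ Ideal.span (Set.range G)) :=
    Module.nontrivial_of_finrank_pos (R := K) (hrank.symm ▸ hD)
  refine ⟨?_, ?_, hfd, hrank, bijOn_fiberSet hsn p Y hY F Ft hFt⟩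
  · rw [Ideal.isRadical_iff_quotient_reduced]
    exact isReduced_of_injective e.symm e.symm.injective
  · have := IsArtinianRing.of_finite K (MvPolynomial (Fin s) K ⧸ Ideal.span (Set.range G))
    exact ringKrullDimZero_iff_ringKrullDim_eq_zero.1 inferInstance
end
end

section
/- Let K be a perfect field, V ⊆ K̄^n an equidimensional K-variety of dimension n − s with I(V) = (F_1, ..., F_s), Y_1, ..., Y_n ∈ K[X_1, ..., X_n] linearly independent linear forms such that π : V → K̄^{n−s} defined by Y_1, ..., Y_{n−s} is a finite morphism, R := K[Y_1, ..., Y_{n−s}], K[V] a free R-module of finite rank D, and p = (p_1, ..., p_{n−s}) ∈ K^{n−s} a lifting point of π. For 1 ≤ i ≤ s, let H_i ∈ K[Y_{n−s}, ..., Y_n] be obtained from F_i by rewriting F_i in the coordinates Y_1, ..., Y_n and substituting p_k for Y_k for 1 ≤ k ≤ n − s − 1. Then H_1, ..., H_s generate a radical ideal of K[Y_{n−s}, ..., Y_n] all of whose minimal primes have coheight s (an equidimensional ideal of dimension 1), the zero set of (H_1, ..., H_s) in K̄^{s+1} is isomorphic to the lifting curve defined by (F_1, ..., F_s) + (Y_1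 − p_1, ..., Y_{n−s−1} − p_{n−s−1}), the variables Y_{n−s}, ..., Y_n are in Noether position with respect to (H_1, ..., H_s) (the quotient is integral over K[Y_{n−s}]), and K[Y_{n−s}, ..., Y_n]/(H_1, ..., H_s) is a free K[Y_{n−s}]-module of rank D. -/
open MvPolynomial

noncomputable section

/-- Substitution of the values `p₁, …, p_{n−s−1}` for the first `n − s − 1` variables of a
polynomial in `n` variables, yielding a polynomial in the last `s + 1` variables. -/
def substFirst' {K : Type*} [Field K] (n s : ℕ) (hsn : s < n) (p : Fin (n - s) → K)
    (f : MvPolynomial (Fin n) K) : MvPolynomial (Fin (s + 1)) K :=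
  MvPolynomial.aeval (fun j : Fin n =>
    if h : (j : ℕ) < n - s - 1 then MvPolynomial.C (p ⟨(j : ℕ), by omega⟩)
    else MvPolynomial.X ⟨(j : ℕ) - (n - s - 1), by have := j.2; omega⟩) f

open scoped KaehlerDifferential

/-- Linearly independent linear forms are an invertible change of coordinates. -/
theorem exists_algHom_inverse_of_linearForms {K : Type*} [Field K] {n : ℕ}
    (Y : Fin n → MvPolynomial (Fin n) K) (hYhom : ∀ i, (Y i).IsHomogeneous 1)
    (hYind : LinearIndependent K Y) :
    ∃ τ : MvPolynomial (Fin n) K →ₐ[K] MvPolynomial (Fin n) K,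
      (∀ f, MvPolynomial.aeval Y (τ f) = f) ∧ ∀ f, τ (MvPolynomial.aeval Y f) = f := by
  have hXind : LinearIndependent K (X : Fin n → MvPolynomial (Fin n) K) :=
    MvPolynomial.linearIndependent_X (Fin n) K
  have hmem : ∀ i, Y i ∈ Submodule.span K (Set.range (X : Fin n → MvPolynomial (Fin n) K)) := by
    intro i
    rw [← homogeneousSubmodule_one_eq_span_X]
    exact hYhom i
  have hspan : Submodule.span K (Set.range Y) =
      Submodule.span K (Set.range (X : Fin n → MvPolynomial (Fin n) K)) := by
    have : FiniteDimensional K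
        (Submodule.span K (Set.range (X : Fin n → MvPolynomial (Fin n) K))) :=
      FiniteDimensional.span_of_finite K (Set.finite_range _)
    refine Submodule.eq_of_le_of_finrank_eq ?_ ?_
    · rw [Submodule.span_le]
      rintro _ ⟨i, rfl⟩
      exact hmem i
    · rw [finrank_span_eq_card hYind, finrank_span_eq_card hXind]
  have hX : ∀ j, ∃ a : Fin n → K, ∑ i, a i • Y i = X j := fun j ↦ by
    rw [← Submodule.mem_span_range_iff_exists_fun K, hspan]
    exact Submodule.subset_span ⟨j, rfl⟩
  choose a ha using hX
  let τ : MvPolynomial (Fin n) K →ₐ[K] MvPolynomial (Fin n) K :=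
    MvPolynomial.aeval fun j ↦ ∑ i, a j i • X i
  have h₁ : (MvPolynomial.aeval Y).comp τ = AlgHom.id K (MvPolynomial (Fin n) K) := by
    ext1 j
    simp [τ, ha]
  have h₁' : ∀ f, MvPolynomial.aeval Y (τ f) = f := fun f ↦ DFunLike.congr_fun h₁ f
  have hτspan : ∀ f ∈ Submodule.span K (Set.range (X : Fin n → MvPolynomial (Fin n) K)),
      τ f ∈ Submodule.span K (Set.range (X : Fin n → MvPolynomial (Fin n) K)) := by
    intro f hf
    induction hf using Submodule.span_induction with
    | mem f hf =>
      obtain ⟨j, rfl⟩ := hf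
      simp only [τ, aeval_X]
      exact Submodule.sum_mem _ fun i _ ↦
        Submodule.smul_mem _ _ (Submodule.subset_span ⟨i, rfl⟩)
    | zero => simp
    | add f g _ _ hf hg => rw [map_add]; exact Submodule.add_mem _ hf hg
    | smul c f _ hf => rw [map_smul]; exact Submodule.smul_mem _ _ hf
  have h₂ : τ.comp (MvPolynomial.aeval Y) = AlgHom.id K (MvPolynomial (Fin n) K) := by
    ext1 i
    obtain ⟨c, hc⟩ := (Submodule.mem_span_range_iff_exists_fun K).1 (hτspan _ (hmem i))
    have hcY : ∑ l, c l • Y l = ∑ l, (Pi.single i 1 : Fin n → K) l • Y l := by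
      have := congrArg (MvPolynomial.aeval Y) hc
      rw [h₁'] at this
      simpa [Pi.single_apply, ite_smul] using this
    have hci : c = Pi.single i 1 := by
      funext l
      exact hYind.eq_coords_of_eq hcY l
    simp [← hc, hci, Pi.single_apply, ite_smul]
  exact ⟨τ, h₁', fun f ↦ DFunLike.congr_fun h₂ f⟩

/-- If a quotient `Q` of a polynomial ring is such that `n` polynomials become constant in `Q`
and their Jacobian determinant becomes a unit, then `Q` is unramified over the base. -/
theorem formallyUnramified_of_isUnit_jacobian {K Q : Type*} [Field K] [CommRing Q] [Algebra K Q]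
    {n : ℕ} (ψ : MvPolynomial (Fin n) K →ₐ[K] Q) (hψ : Function.Surjective ψ)
    (J : Matrix (Fin n) (Fin n) (MvPolynomial (Fin n) K)) (G : Fin n → MvPolynomial (Fin n) K)
    (hJ : ∀ i j, J i j = pderiv j (G i))
    (hG : ∀ i, ∃ a : K, ψ (G i) = algebraMap K Q a) (hdet : IsUnit (ψ J.det)) :
    Algebra.FormallyUnramified K Q := by
  let _ := ψ.toRingHom.toAlgebra
  have : IsScalarTower K (MvPolynomial (Fin n) K) Q :=
    IsScalarTower.of_algebraMap_eq fun x ↦ (ψ.commutes x).symm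
  let d : Derivation K (MvPolynomial (Fin n) K) (Ω[Q⁄K]) :=
    (KaehlerDifferential.D K Q).compAlgebraMap (MvPolynomial (Fin n) K)
  have hd : ∀ f, d f = KaehlerDifferential.D K Q (ψ f) := fun f ↦ rfl
  have hchain : ∀ f, d f = ∑ j, pderiv j f • d (X j) := by
    intro f
    let d' : Derivation K (MvPolynomial (Fin n) K) (Ω[Q⁄K]) :=
      ∑ j, (LinearMap.toSpanSingleton (MvPolynomial (Fin n) K) _ (d (X j))).compDer (pderiv j)
    have hd' : ∀ f, d' f = ∑ j, pderiv j f • d (X j) := by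
      intro f
      have hsum : ⇑d' = ∑ j, ⇑((LinearMap.toSpanSingleton (MvPolynomial (Fin n) K) _
          (d (X j))).compDer (pderiv j)) := map_sum Derivation.coeFnAddMonoidHom _ _
      rw [hsum, Finset.sum_apply]
      simp
    rw [← hd']
    congr 1
    refine derivation_ext fun i ↦ ?_
    rw [hd']
    simp [pderiv_X, Pi.single_apply, ite_smul]
  have hrel : ∀ i, ∑ j, J i j • d (X j) = 0 := by
    intro i
    obtain ⟨a, ha⟩ := hG i
    simp_rw [hJ, ← hchain, hd, ha, Derivation.map_algebraMap]
  have hX : ∀ k, d (X k) = 0 := by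
    intro k
    have h : J.det • d (X k) = 0 := by
      have hk : ∑ i, J.adjugate k i • ∑ j, J i j • d (X j) = J.det • d (X k) := by
        simp_rw [Finset.smul_sum, smul_smul]
        rw [Finset.sum_comm]
        simp_rw [← Finset.sum_smul, ← Matrix.mul_apply, Matrix.adjugate_mul, Matrix.smul_apply,
          Matrix.one_apply]
        simp [ite_smul]
      rw [← hk]
      simp [hrel]
    exact hdet.smul_eq_zero.1 h
  have hzero : ∀ q, KaehlerDifferential.D K Q q = 0 := by
    intro q
    obtain ⟨f, rfl⟩ := hψ q
    rw [← hd, hchain]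
    simp [hX]
  refine ⟨⟨fun x y ↦ ?_⟩⟩
  have hall : ∀ x : Ω[Q⁄K], x = 0 := by
    intro x
    have hx : x ∈ Submodule.span Q (Set.range (KaehlerDifferential.D K Q)) := by
      rw [KaehlerDifferential.span_range_derivation]; trivial
    induction hx using Submodule.span_induction with
    | mem x hx => obtain ⟨q, rfl⟩ := hx; exact hzero q
    | zero => rfl
    | add x y _ _ hx hy => rw [hx, hy, add_zero]
    | smul c x _ hx => rw [hx, smul_zero]
  rw [hall x, hall y]

/-- An element of a finitely generated algebra over a field that vanishes at no geometric point is
a unit. -/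
theorem isUnit_of_forall_algHom_ne_zero {K Q : Type*} [Field K] [CommRing Q] [Algebra K Q]
    [Algebra.FiniteType K Q] (q : Q) (hq : ∀ χ : Q →ₐ[K] AlgebraicClosure K, χ q ≠ 0) :
    IsUnit q := by
  by_contra h
  obtain ⟨M, hM, hqM⟩ := exists_max_ideal_of_mem_nonunits h
  let _ := Ideal.Quotient.field M
  have : Module.Finite K (Q ⧸ M) := finite_of_finite_type_of_isJacobsonRing K (Q ⧸ M)
  let e : (Q ⧸ M) →ₐ[K] AlgebraicClosure K := IsAlgClosed.lift
  refine hq (e.comp (Ideal.Quotient.mkₐ K M)) ?_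
  simp [Ideal.Quotient.eq_zero_iff_mem.2 hqM]

/-- A finite free algebra over `K[T]` with a reduced fiber at some rational point is reduced. -/
theorem isReduced_of_isReduced_fiber {K C : Type*} [Field K] [CommRing C]
    [Algebra (Polynomial K) C] [Module.Free (Polynomial K) C] (a : K)
    (h : IsReduced (C ⧸ Ideal.span
      {algebraMap (Polynomial K) C (Polynomial.X - Polynomial.C a)})) :
    IsReduced C := by
  set t : Polynomial K := Polynomial.X - Polynomial.C a with ht
  have ht0 : t ≠ 0 := Polynomial.X_sub_C_ne_zero a
  have hdiv : ∀ c : C, IsNilpotent c → ∃ c', IsNilpotent c' ∧ c = t • c' := by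
    intro c hc
    have hc0 : Ideal.Quotient.mk (Ideal.span {algebraMap (Polynomial K) C t}) c = 0 :=
      (hc.map (Ideal.Quotient.mk _)).eq_zero
    rw [Ideal.Quotient.eq_zero_iff_mem, Ideal.mem_span_singleton] at hc0
    obtain ⟨c', rfl⟩ := hc0
    refine ⟨c', ?_, by rw [Algebra.smul_def]⟩
    obtain ⟨k, hk⟩ := hc
    refine ⟨k, ?_⟩
    rw [mul_pow, ← map_pow, ← Algebra.smul_def] at hk
    exact (smul_eq_zero.1 hk).resolve_left (pow_ne_zero k ht0)
  have hpow : ∀ (k : ℕ) (c : C), IsNilpotent c → ∃ c', c = t ^ k • c' := by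
    intro k
    induction k with
    | zero => exact fun c _ ↦ ⟨c, by simp⟩
    | succ k ih =>
      intro c hc
      obtain ⟨c₁, hc₁, rfl⟩ := hdiv c hc
      obtain ⟨c₂, rfl⟩ := ih c₁ hc₁
      exact ⟨c₂, by rw [smul_smul, pow_succ']⟩
  refine ⟨fun c hc ↦ ?_⟩
  let b := Module.Free.chooseBasis (Polynomial K) C
  refine b.ext_elem fun i ↦ ?_
  rw [map_zero, Finsupp.zero_apply]
  by_contra hi
  obtain ⟨c', hc'⟩ := hpow ((b.repr c i).natDegree + 1) c hc
  have hdvd : t ^ ((b.repr c i).natDegree + 1) ∣ b.repr c i := by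
    refine ⟨b.repr c' i, ?_⟩
    conv_lhs => rw [hc']
    simp
  have := Polynomial.natDegree_le_of_dvd hdvd hi
  rw [Polynomial.natDegree_pow, ht, Polynomial.natDegree_X_sub_C] at this
  omega

/-- The components of a finite free `K[T]`-algebra are curves. -/
theorem ringKrullDim_quotient_minimalPrimes_eq_one {K A : Type*} [Field K] [CommRing A]
    {I : Ideal A} [Algebra (Polynomial K) A] [Module.Free (Polynomial K) (A ⧸ I)]
    [Module.Finite (Polynomial K) (A ⧸ I)] {P : Ideal A} (hP : P ∈ I.minimalPrimes) :
    ringKrullDim (A ⧸ P) = 1 := by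
  have := hP.1.1
  have hIP : I ≤ P := hP.1.2
  have : Algebra.IsIntegral (Polynomial K) (A ⧸ P) := by
    refine Algebra.IsIntegral.of_surjective (Ideal.Quotient.factorₐ (Polynomial K) hIP)
      (Ideal.Quotient.factor_surjective hIP)
  have hinj : Function.Injective (algebraMap (Polynomial K) (A ⧸ P)) := by
    rw [injective_iff_map_eq_zero]
    intro f hf
    by_contra hf0
    rw [IsScalarTower.algebraMap_apply (Polynomial K) A (A ⧸ P), Ideal.Quotient.algebraMap_eq,
      Ideal.Quotient.eq_zero_iff_mem] at hf
    obtain ⟨y, hy, hfy⟩ := Ideal.exists_mul_mem_of_mem_minimalPrimes hP hf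
    rw [← Algebra.smul_def, ← Ideal.Quotient.eq_zero_iff_mem] at hfy
    have : f • Ideal.Quotient.mk I y = 0 := hfy
    exact hy (Ideal.Quotient.eq_zero_iff_mem.1 ((smul_eq_zero.1 this).resolve_left hf0))
  have : Ring.DimensionLEOne (A ⧸ P) := Ring.DimensionLEOne.of_isIntegral (Polynomial K) (A ⧸ P)
  refine eq_of_le_of_not_lt ?_ fun h ↦ Polynomial.not_isField K ?_
  · rw [← Nat.cast_one, ← Ring.krullDimLE_iff]
    infer_instance
  · have h' : ringKrullDim (A ⧸ P) ≤ 0 := Order.le_of_lt_succ h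
    rw [← Nat.cast_zero, ← Ring.krullDimLE_iff] at h'
    exact (Algebra.IsIntegral.isField_iff_isField hinj).2 Ring.KrullDimLE.isField_of_isDomain

/-- A basis of an `R`-algebra `B` maps to a basis of the `S`-algebra `C = B ⊗[R] S`, where `S` is
a quotient of `R`. -/
theorem basis_of_surjective {k R S B C : Type*} [CommRing k] [CommRing R] [CommRing S] [CommRing B]
    [CommRing C] [Algebra k R] [Algebra k S] [Algebra k B] [Algebra k C]
    {D : ℕ} (α : R →ₐ[k] B) (ρ : R →ₐ[k] S) (β : B →ₐ[k] C) (γ : S →ₐ[k] C)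
    (hρ : Function.Surjective ρ) (hβ : Function.Surjective β)
    (hcomm : ∀ r, β (α r) = γ (ρ r)) (hker : RingHom.ker β ≤ (RingHom.ker ρ).map α)
    (g : Fin D → B) (hgen : ∀ b, ∃ c : Fin D → R, b = ∑ i, α (c i) * g i)
    (hind : ∀ c : Fin D → R, ∑ i, α (c i) * g i = 0 → ∀ i, c i = 0) :
    (∀ b, ∃ c : Fin D → S, b = ∑ i, γ (c i) * β (g i)) ∧
      ∀ c : Fin D → S, ∑ i, γ (c i) * β (g i) = 0 → ∀ i, c i = 0 := by
  constructor
  · intro b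
    obtain ⟨b, rfl⟩ := hβ b
    obtain ⟨c, rfl⟩ := hgen b
    exact ⟨fun i ↦ ρ (c i), by simp [map_sum, hcomm]⟩
  · intro c hc
    choose c' hc' using fun i ↦ hρ (c i)
    have hmem : ∑ i, α (c' i) * g i ∈ (RingHom.ker ρ).map α := by
      refine hker ?_
      rw [RingHom.mem_ker, map_sum, ← hc]
      simp [hcomm, hc']
    have hcoord : ∀ b ∈ (RingHom.ker ρ).map α,
        ∃ e : Fin D → R, (∀ i, ρ (e i) = 0) ∧ b = ∑ i, α (e i) * g i := by
      intro b hb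
      refine Submodule.span_induction ?_ ⟨0, by simp, by simp⟩ ?_ ?_ hb
      · rintro _ ⟨r, hr, rfl⟩
        obtain ⟨e, he⟩ := hgen 1
        have hr' : ρ r = 0 := hr
        refine ⟨fun i ↦ r * e i, fun i ↦ by simp [hr'], ?_⟩
        simp_rw [map_mul, mul_assoc, ← Finset.mul_sum, ← he, mul_one]
      · rintro _ _ _ _ ⟨e, he, rfl⟩ ⟨e', he', rfl⟩
        exact ⟨e + e', by simp [he, he'], by simp [add_mul, Finset.sum_add_distrib]⟩
      · rintro x _ _ ⟨e, he, rfl⟩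
        choose m hm using fun i ↦ hgen (x * g i)
        refine ⟨fun j ↦ ∑ i, e i * m i j, fun j ↦ by simp [he], ?_⟩
        simp_rw [smul_eq_mul, Finset.mul_sum, map_sum, Finset.sum_mul]
        rw [Finset.sum_comm]
        refine Finset.sum_congr rfl fun i _ ↦ ?_
        rw [mul_left_comm, hm i, Finset.mul_sum]
        exact Finset.sum_congr rfl fun j _ ↦ by rw [map_mul, mul_assoc]
    obtain ⟨e, he, hsum⟩ := hcoord _ hmem
    intro i
    have h0 := hind (fun i ↦ c' i - e i) (by
      simp_rw [map_sub, sub_mul, Finset.sum_sub_distrib, hsum, sub_self]) i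
    rw [← hc' i, sub_eq_zero.1 h0, he]

/-- An algebra of functions on the fiber of the projection over a lifting point is reduced. -/
theorem isReduced_of_isLiftingPoint {K Q : Type*} [Field K] [CommRing Q] [Algebra K Q] (n s : ℕ)
    (hsn : s ≤ n) (V : Set (Fin n → AlgebraicClosure K)) (Y : Fin (n - s) → MvPolynomial (Fin n) K)
    (F : Fin s → MvPolynomial (Fin n) K) (hV : V = mvZeroSet (Set.range F)) (p : Fin (n - s) → K)
    (hp : IsLiftingPoint n s hsn V Y F p)
    (ψ : MvPolynomial (Fin n) K →ₐ[K] Q) (hψsurj : Function.Surjective ψ)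
    (hψF : ∀ i, ψ (F i) = 0)
    (hψY : ∀ i, ψ (Y i) = algebraMap K Q (p i)) :
    IsReduced Q := by
  have hfinType : Algebra.FiniteType K Q :=
    Algebra.FiniteType.of_surjective ψ hψsurj
  have hunit : IsUnit (ψ (jacMat n s hsn Y F).det) := by
    refine isUnit_of_forall_algHom_ne_zero (K := K) _ fun χ ↦ ?_
    have hχ : ∀ f, MvPolynomial.aeval (fun j ↦ χ (ψ (X j))) f = χ (ψ f) := by
      intro f
      have : MvPolynomial.aeval (fun j ↦ χ (ψ (X j))) = χ.comp ψ := by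
        ext1 j
        simp
      exact DFunLike.congr_fun this f
    rw [← hχ]
    refine hp _ ⟨?_, fun i ↦ ?_⟩
    · rw [hV]
      rintro _ ⟨i, rfl⟩
      rw [hχ, hψF, map_zero]
    · rw [hχ, hψY, χ.commutes]
  have hunram := formallyUnramified_of_isUnit_jacobian ψ hψsurj _ (fun i : Fin n ↦
    if h : (i : ℕ) < n - s then Y ⟨(i : ℕ), h⟩
    else F ⟨(i : ℕ) - (n - s), by have h2 := i.2; omega⟩) (by
      intro i j
      simp only [jacMat, Matrix.of_apply]
      split_ifs <;> rfl) (by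
      intro i
      by_cases h : (i : ℕ) < n - s
      · exact ⟨p ⟨i, h⟩, by simp only [dif_pos h]; exact hψY ⟨i, h⟩⟩
      · exact ⟨0, by simp only [dif_neg h, hψF, map_zero]⟩) hunit
  exact Algebra.FormallyUnramified.isReduced_of_field K _

/-- An algebra of functions on the lifting curve, restricted to the fiber over a lifting point, is
reduced. -/
theorem isReduced_quotient_of_isLiftingPoint {K C : Type*} [Field K] [CommRing C] [Algebra K C]
    (n s : ℕ) (hsn : s ≤ n) (V : Set (Fin n → AlgebraicClosure K))
    (Y : Fin (n - s) → MvPolynomial (Fin n) K) (F : Fin s → MvPolynomial (Fin n) K)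
    (hV : V = mvZeroSet (Set.range F)) (p : Fin (n - s) → K)
    (hp : IsLiftingPoint n s hsn V Y F p)
    (ψ : MvPolynomial (Fin n) K →ₐ[K] C) (hψsurj : Function.Surjective ψ)
    (hψF : ∀ i, ψ (F i) = 0) (T : Ideal C)
    (hψY : ∀ i, ψ (Y i) - algebraMap K C (p i) ∈ T) :
    IsReduced (C ⧸ T) :=
  isReduced_of_isLiftingPoint n s hsn V Y F hV p hp ((Ideal.Quotient.mkₐ K T).comp ψ)
    ((Ideal.Quotient.mkₐ_surjective K T).comp hψsurj) (fun i ↦ by simp [hψF])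
    (fun i ↦ Ideal.Quotient.eq.2 (hψY i))

/-- Let the coordinates `Y` of affine space be split into two blocks `ι` and `κ`. The coordinates
of the second block identify the slice of `V` where the first block takes the value `p` with the
zero set of the restrictions of the equations of `V` to that slice. -/
theorem bijOn_slice {K : Type*} [Field K] {n m r s : ℕ} (ι : Fin m → Fin n) (κ : Fin r → Fin n)
    (hικ : ∀ j, (∃ i, ι i = j) ∨ ∃ i, κ i = j)
    (V : Set (Fin n → AlgebraicClosure K)) (F : Fin s → MvPolynomial (Fin n) K)
    (hV : V = mvZeroSet (Set.range F)) (Y : Fin n → MvPolynomial (Fin n) K) (p : Fin m → K)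
    (φ : MvPolynomial (Fin n) K →ₐ[K] MvPolynomial (Fin r) K)
    (hφι : ∀ i, φ (Y (ι i)) = C (p i)) (hφκ : ∀ i, φ (Y (κ i)) = X i)
    {H : Fin s → MvPolynomial (Fin r) K} (hφF : ∀ i, φ (F i) = H i)
    (hY : Function.Surjective (MvPolynomial.aeval (R := K) Y)) :
    Set.BijOn (fun x i ↦ MvPolynomial.aeval x (Y (κ i)))
      {x : Fin n → AlgebraicClosure K | x ∈ V ∧ ∀ i,
        MvPolynomial.aeval x (Y (ι i)) = algebraMap K (AlgebraicClosure K) (p i)}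
      {y : Fin r → AlgebraicClosure K | ∀ i, MvPolynomial.aeval y (H i) = 0} := by
  have hslice : ∀ (x : Fin n → AlgebraicClosure K) (y : Fin r → AlgebraicClosure K),
      (∀ j, MvPolynomial.aeval x (Y j) = MvPolynomial.aeval y (φ (Y j))) →
      ∀ f, MvPolynomial.aeval x f = MvPolynomial.aeval y (φ f) := by
    intro x y hxy f
    obtain ⟨f, rfl⟩ := hY f
    have : (MvPolynomial.aeval x).comp (MvPolynomial.aeval Y) =
        ((MvPolynomial.aeval y).comp φ).comp (MvPolynomial.aeval Y) := by
      ext1 j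
      simp [hxy]
    exact DFunLike.congr_fun this f
  have hcurve : ∀ x : Fin n → AlgebraicClosure K,
      (∀ i, MvPolynomial.aeval x (Y (ι i)) = algebraMap K (AlgebraicClosure K) (p i)) →
      ∀ j, MvPolynomial.aeval x (Y j) =
        MvPolynomial.aeval (fun i ↦ MvPolynomial.aeval x (Y (κ i))) (φ (Y j)) := by
    intro x hx j
    obtain ⟨i, rfl⟩ | ⟨i, rfl⟩ := hικ j
    · rw [hφι, aeval_C, hx]
    · rw [hφκ, aeval_X]
  refine ⟨?_, ?_, ?_⟩
  · rintro x ⟨hxV, hx⟩ i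
    rw [← hφF, ← hslice x _ (hcurve x hx)]
    rw [hV] at hxV
    exact hxV _ ⟨i, rfl⟩
  · rintro x ⟨-, hx⟩ x' ⟨-, hx'⟩ hxx'
    funext j
    have h₁ := hslice x _ (hcurve x hx) (X j)
    have h₂ := hslice x' _ (hcurve x' hx') (X j)
    rw [aeval_X] at h₁ h₂
    rw [h₁, h₂]
    exact congrArg (fun y ↦ MvPolynomial.aeval y (φ (X j))) hxx'
  · intro y hy
    let x : Fin n → AlgebraicClosure K := fun j ↦ MvPolynomial.aeval y (φ (X j))
    have hx : ∀ f, MvPolynomial.aeval x f = MvPolynomial.aeval y (φ f) := by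
      intro f
      have : MvPolynomial.aeval x = (MvPolynomial.aeval y).comp φ := by
        ext1 j
        simp [x]
      exact DFunLike.congr_fun this f
    refine ⟨x, ⟨?_, fun i ↦ ?_⟩, ?_⟩
    · rw [hV]
      rintro _ ⟨i, rfl⟩
      rw [hx, hφF]
      exact hy i
    · rw [hx, hφι, aeval_C]
    · funext i
      simp only [hx, hφκ, aeval_X]

/-- second part of Lemma 4.3 of the paper. -/
theorem stmt_7 {K : Type*} [Field K] [PerfectField K] (n s D : ℕ) (hsn : s < n)
    (V : Set (Fin n → AlgebraicClosure K))
    (F : Fin s → MvPolynomial (Fin n) K)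
    (hV : V = mvZeroSet (Set.range F))
    (hIV : mvVanishingIdeal V = Ideal.span (Set.range F))
    (hequi : ∀ P ∈ (mvVanishingIdeal V).minimalPrimes,
      ringKrullDim (MvPolynomial (Fin n) K ⧸ P) = ((n - s : ℕ) : WithBot ℕ∞))
    (Y : Fin n → MvPolynomial (Fin n) K)
    (hYhom : ∀ i, (Y i).IsHomogeneous 1)
    (hYind : LinearIndependent K Y)
    -- `π : V → K̄^{n−s}` defined by `Y₁, …, Y_{n−s}` is a finite morphism
    (hfin : Function.Injective (coordMap (mvVanishingIdeal V)
        (fun i : Fin (n - s) => Y ⟨(i : ℕ), by have := i.2; omega⟩)) ∧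
      RingHom.IsIntegral (coordMap (mvVanishingIdeal V)
        (fun i : Fin (n - s) => Y ⟨(i : ℕ), by have := i.2; omega⟩)).toRingHom)
    -- `K[V]` is a free `R`-module of finite rank `D`
    (hfree : ∃ g : Fin D → MvPolynomial (Fin n) K ⧸ mvVanishingIdeal V,
      IsFreeBasisOver (mvVanishingIdeal V)
        (fun i : Fin (n - s) => Y ⟨(i : ℕ), by have := i.2; omega⟩) g)
    -- `p` is a lifting point of `π`
    (p : Fin (n - s) → K)
    (hp : IsLiftingPoint n s hsn.le V
      (fun i : Fin (n - s) => Y ⟨(i : ℕ), by have := i.2; omega⟩) F p)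
    -- `Ft i` is `F i` rewritten in the coordinates `Y₁, …, Yₙ`
    (Ft : Fin s → MvPolynomial (Fin n) K)
    (hFt : ∀ i, MvPolynomial.aeval Y (Ft i) = F i) :
    -- with `H i = F i (p*, Y_{n−s}, …, Yₙ)`:
    let H : Fin s → MvPolynomial (Fin (s + 1)) K := fun i => substFirst' n s hsn p (Ft i);
    -- `H₁, …, H_s` generate a radical equidimensional ideal of dimension `1`,
    (Ideal.span (Set.range H)).IsRadical ∧
    (∀ P ∈ (Ideal.span (Set.range H)).minimalPrimes,
      ringKrullDim (MvPolynomial (Fin (s + 1)) K ⧸ P) = ((1 : ℕ) : WithBot ℕ∞)) ∧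
    -- the zero set of `H₁, …, H_s` in `K̄^{s+1}` is isomorphic to the lifting curve,
    Set.BijOn
      (fun x (i : Fin (s + 1)) =>
        MvPolynomial.aeval x (Y ⟨n - s - 1 + (i : ℕ), by have := i.2; omega⟩))
      {x : Fin n → AlgebraicClosure K | x ∈ V ∧ ∀ i : Fin (n - s - 1),
        MvPolynomial.aeval x (Y ⟨(i : ℕ), by have := i.2; omega⟩) =
          algebraMap K (AlgebraicClosure K) (p ⟨(i : ℕ), by have := i.2; omega⟩)}
      {y : Fin (s + 1) → AlgebraicClosure K | ∀ i, MvPolynomial.aeval y (H i) = 0} ∧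
    -- `Y_{n−s}, …, Yₙ` are in Noether position with respect to `(H₁, …, H_s)`,
    RingHom.IsIntegral ((Polynomial.aeval
      (Ideal.Quotient.mk (Ideal.span (Set.range H))
        (MvPolynomial.X (0 : Fin (s + 1)))) :
        Polynomial K →ₐ[K] MvPolynomial (Fin (s + 1)) K ⧸ Ideal.span (Set.range H)).toRingHom) ∧
    -- and the quotient is a free `K[Y_{n−s}]`-module of rank `D`
    (∃ g : Fin D → MvPolynomial (Fin (s + 1)) K ⧸ Ideal.span (Set.range H),
      (∀ b : MvPolynomial (Fin (s + 1)) K ⧸ Ideal.span (Set.range H),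
        ∃ c : Fin D → Polynomial K,
          b = ∑ i, Polynomial.aeval
            (Ideal.Quotient.mk (Ideal.span (Set.range H))
              (MvPolynomial.X (0 : Fin (s + 1)))) (c i) * g i) ∧
      (∀ c : Fin D → Polynomial K,
        (∑ i, Polynomial.aeval
          (Ideal.Quotient.mk (Ideal.span (Set.range H))
            (MvPolynomial.X (0 : Fin (s + 1)))) (c i) * g i) = 0 → ∀ i, c i = 0)) := by
  intro H
  obtain ⟨τ, hτ₁, hτ₂⟩ := exists_algHom_inverse_of_linearForms Y hYhom hYind
  have hY : Function.Surjective (MvPolynomial.aeval (R := K) Y) := fun f ↦ ⟨τ f, hτ₁ f⟩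
  -- the coordinates of the slice, as functions on it
  let z : Fin n → MvPolynomial (Fin (s + 1)) K := fun j ↦
    if h : (j : ℕ) < n - s - 1 then MvPolynomial.C (p ⟨(j : ℕ), by omega⟩)
    else MvPolynomial.X ⟨(j : ℕ) - (n - s - 1), by have := j.2; omega⟩
  have hz₁ : ∀ (j : Fin n) (h : (j : ℕ) < n - s - 1),
      z j = MvPolynomial.C (p ⟨(j : ℕ), by omega⟩) := fun j h ↦ dif_pos h
  have hz₂ : ∀ i : Fin (s + 1), z ⟨n - s - 1 + (i : ℕ), by have := i.2; omega⟩ = X i := by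
    intro i
    simp [z]
  let φ : MvPolynomial (Fin n) K →ₐ[K] MvPolynomial (Fin (s + 1)) K :=
    (MvPolynomial.aeval z).comp τ
  have hφY : ∀ j, φ (Y j) = z j := by
    intro j
    have := hτ₂ (X j)
    rw [aeval_X] at this
    simp [φ, this]
  have hφF : ∀ i, φ (F i) = H i := by
    intro i
    rw [← hFt i]
    simp only [φ, AlgHom.comp_apply, hτ₂]
    rfl
  have hφsection : ∀ f, φ (MvPolynomial.aeval
      (fun i : Fin (s + 1) ↦ Y ⟨n - s - 1 + (i : ℕ), by have := i.2; omega⟩) f) = f := by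
    intro f
    have : φ.comp (MvPolynomial.aeval
        (fun i : Fin (s + 1) ↦ Y ⟨n - s - 1 + (i : ℕ), by have := i.2; omega⟩)) =
        AlgHom.id K _ := by
      ext1 i
      simp [hφY, hz₂]
    exact DFunLike.congr_fun this f
  have hφsurj : Function.Surjective φ := fun f ↦ ⟨_, hφsection f⟩
  set I := mvVanishingIdeal V
  set L := Ideal.span (Set.range H)
  have hmap : I.map φ = L := by
    rw [hIV, Ideal.map_span, ← Set.range_comp]
    congr 2
    exact funext hφF
  have hIL : I ≤ L.comap φ := by
    rw [← hmap]
    exact Ideal.le_comap_map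
  let β : (MvPolynomial (Fin n) K ⧸ I) →ₐ[K] MvPolynomial (Fin (s + 1)) K ⧸ L :=
    Ideal.quotientMapₐ L φ hIL
  have hβmk : ∀ f, β (Ideal.Quotient.mk I f) = Ideal.Quotient.mk L (φ f) := fun f ↦ rfl
  have hβsurj : Function.Surjective β := by
    intro c
    obtain ⟨c, rfl⟩ := Ideal.Quotient.mk_surjective c
    obtain ⟨f, rfl⟩ := hφsurj c
    exact ⟨Ideal.Quotient.mk I f, hβmk f⟩
  let α := coordMap I (fun i : Fin (n - s) ↦ Y ⟨(i : ℕ), by have := i.2; omega⟩)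
  have hαX : ∀ i, α (X i) = Ideal.Quotient.mk I (Y ⟨(i : ℕ), by have := i.2; omega⟩) := by
    intro i
    simp [α, coordMap]
  let ρ : MvPolynomial (Fin (n - s)) K →ₐ[K] Polynomial K := MvPolynomial.aeval fun j ↦
    if (j : ℕ) < n - s - 1 then Polynomial.C (p j) else Polynomial.X
  have hρX : ∀ j : Fin (n - s), ρ (X j) =
      if (j : ℕ) < n - s - 1 then Polynomial.C (p j) else Polynomial.X := fun j ↦ aeval_X _ j
  let last : Fin (n - s) := ⟨n - s - 1, by omega⟩
  have hρsurj : Function.Surjective ρ := by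
    intro f
    refine ⟨Polynomial.aeval (X last) f, ?_⟩
    rw [← Polynomial.aeval_algHom_apply, hρX]
    simp [last]
  let γ : Polynomial K →ₐ[K] MvPolynomial (Fin (s + 1)) K ⧸ L :=
    Polynomial.aeval (Ideal.Quotient.mk L (X 0))
  have hcomm : ∀ r, β (α r) = γ (ρ r) := by
    have : β.comp α = γ.comp ρ := by
      ext1 j
      simp only [AlgHom.comp_apply]
      rw [hαX, hβmk, hφY, hρX]
      split_ifs with h
      · rw [hz₁ _ h]
        simp only [γ, Polynomial.aeval_C]
        rfl
      · have hj : (⟨(j : ℕ), by have := j.2; omega⟩ : Fin n) =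
            ⟨n - s - 1 + ((0 : Fin (s + 1)) : ℕ), by simp; omega⟩ := by
          have := j.2
          ext
          simp
          omega
        rw [hj, hz₂]
        simp [γ]
    exact fun r ↦ DFunLike.congr_fun this r
  have hker : RingHom.ker β ≤ (RingHom.ker ρ).map α := by
    set J := (RingHom.ker ρ).map α
    have hsec : ∀ f, Ideal.Quotient.mk J (Ideal.Quotient.mk I f) =
        Ideal.Quotient.mk J (Ideal.Quotient.mk I (MvPolynomial.aeval
          (fun i : Fin (s + 1) ↦ Y ⟨n - s - 1 + (i : ℕ), by have := i.2; omega⟩) (φ f))) := by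
      let q : MvPolynomial (Fin n) K →ₐ[K] (MvPolynomial (Fin n) K ⧸ I) ⧸ J :=
        (Ideal.Quotient.mkₐ K J).comp (Ideal.Quotient.mkₐ K I)
      let σ : MvPolynomial (Fin (s + 1)) K →ₐ[K] MvPolynomial (Fin n) K := MvPolynomial.aeval
        (fun i : Fin (s + 1) ↦ Y ⟨n - s - 1 + (i : ℕ), by have := i.2; omega⟩)
      have h : q.comp (MvPolynomial.aeval Y) =
          (q.comp (σ.comp φ)).comp (MvPolynomial.aeval Y) := by
        ext1 j
        simp only [AlgHom.comp_apply, aeval_X, hφY]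
        by_cases hj : (j : ℕ) < n - s - 1
        · rw [hz₁ j hj]
          have hmem : α (X ⟨(j : ℕ), by omega⟩ - C (p ⟨(j : ℕ), by omega⟩)) ∈ J := by
            refine Ideal.mem_map_of_mem α ?_
            rw [RingHom.mem_ker]
            rw [map_sub, hρX, if_pos hj, ← algebraMap_eq, ρ.commutes]
            exact sub_self _
          rw [← Ideal.Quotient.eq_zero_iff_mem, map_sub, map_sub, sub_eq_zero, hαX,
            ← algebraMap_eq, α.commutes] at hmem
          rw [← algebraMap_eq, σ.commutes, q.commutes]
          exact hmem
        · have hj' : j = ⟨n - s - 1 + (j - (n - s - 1)), by have := j.2; omega⟩ := by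
            ext
            simp
            omega
          have h' := hz₂ ⟨(j : ℕ) - (n - s - 1), by have := j.2; omega⟩
          simp only [← hj'] at h'
          rw [h']
          simp only [σ, aeval_X, ← hj']
      intro f
      have := DFunLike.congr_fun h (τ f)
      simp only [AlgHom.comp_apply, hτ₁] at this
      exact this
    intro b hb
    obtain ⟨f, rfl⟩ := Ideal.Quotient.mk_surjective b
    have hfL : φ f ∈ I.map φ := by
      rw [hmap, ← Ideal.Quotient.eq_zero_iff_mem]
      exact hb
    obtain ⟨f', hf', hff'⟩ := (Ideal.mem_map_iff_of_surjective φ hφsurj).1 hfL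
    rw [← Ideal.Quotient.eq_zero_iff_mem, hsec, ← hff', ← hsec,
      Ideal.Quotient.eq_zero_iff_mem.2 hf', map_zero]
  obtain ⟨g, hgen, hind⟩ := hfree
  obtain ⟨hgen', hind'⟩ := basis_of_surjective α ρ β γ hρsurj hβsurj hcomm hker
    g hgen hind
  let γ₀ : Polynomial K →ₐ[K] MvPolynomial (Fin (s + 1)) K := Polynomial.aeval (X 0)
  let _ : Algebra (Polynomial K) (MvPolynomial (Fin (s + 1)) K) := γ₀.toRingHom.toAlgebra
  have hγ : ∀ f, algebraMap (Polynomial K) (MvPolynomial (Fin (s + 1)) K ⧸ L) f = γ f := by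
    intro f
    have : (Ideal.Quotient.mkₐ K L).comp γ₀ = γ := by
      ext1
      simp [γ, γ₀]
    exact DFunLike.congr_fun this f
  have hsmul : ∀ (f : Polynomial K) (x : MvPolynomial (Fin (s + 1)) K ⧸ L), f • x = γ f * x :=
    fun f x ↦ (Algebra.smul_def f x).trans (by rw [hγ])
  let b : Module.Basis (Fin D) (Polynomial K) (MvPolynomial (Fin (s + 1)) K ⧸ L) :=
    Module.Basis.mk (v := fun i ↦ β (g i))
      (Fintype.linearIndependent_iff.2 fun c hc ↦ hind' c
        ((Finset.sum_congr rfl fun i _ ↦ (hsmul (c i) (β (g i))).symm).trans hc))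
      (fun x _ ↦ by
        obtain ⟨c, rfl⟩ := hgen' x
        refine Submodule.sum_mem _ fun i _ ↦ ?_
        change γ (c i) * β (g i) ∈ _
        rw [← hsmul]
        exact Submodule.smul_mem _ _ (Submodule.subset_span ⟨i, rfl⟩))
  have hFree : Module.Free (Polynomial K) (MvPolynomial (Fin (s + 1)) K ⧸ L) :=
    Module.Free.of_basis b
  have hFinite : Module.Finite (Polynomial K) (MvPolynomial (Fin (s + 1)) K ⧸ L) :=
    Module.Finite.of_basis b
  refine ⟨?_, ?_, ?_, ?_, fun i ↦ β (g i), hgen', hind'⟩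
  · rw [Ideal.isRadical_iff_quotient_reduced]
    refine isReduced_of_isReduced_fiber (p last) ?_
    refine isReduced_quotient_of_isLiftingPoint n s hsn.le V _ F hV p hp
      ((Ideal.Quotient.mkₐ K L).comp φ) ((Ideal.Quotient.mkₐ_surjective K L).comp hφsurj)
      (fun i ↦ ?_) _ (fun i ↦ ?_)
    · rw [AlgHom.comp_apply, hφF]
      exact Ideal.Quotient.eq_zero_iff_mem.2 (Ideal.subset_span ⟨i, rfl⟩)
    · have h₁ : (Ideal.Quotient.mkₐ K L).comp φ (Y ⟨(i : ℕ), by have := i.2; omega⟩) =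
          γ (ρ (X i)) := by
        rw [← hcomm, hαX]
        rfl
      rw [h₁, hρX, ← γ.commutes, ← map_sub, Polynomial.algebraMap_eq]
      split_ifs with h
      · rw [sub_self, map_zero]
        exact Ideal.zero_mem _
      · have hi : i = last := by
          have := i.2
          ext
          simp only [last]
          omega
        rw [hi, ← hγ]
        exact Ideal.subset_span rfl
  · intro P hP
    rw [Nat.cast_one]
    exact ringKrullDim_quotient_minimalPrimes_eq_one (K := K) hP
  · refine bijOn_slice (fun i : Fin (n - s - 1) ↦ ⟨(i : ℕ), by have := i.2; omega⟩)
      (fun i : Fin (s + 1) ↦ ⟨n - s - 1 + (i : ℕ), by have := i.2; omega⟩) (fun j ↦ ?_) V F hV Y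
      (fun i ↦ p ⟨(i : ℕ), by have := i.2; omega⟩) φ (fun i ↦ by rw [hφY, hz₁ _ i.2])
      (fun i ↦ by rw [hφY, hz₂]) hφF hY
    by_cases hj : (j : ℕ) < n - s - 1
    · exact Or.inl ⟨⟨j, hj⟩, rfl⟩
    · refine Or.inr ⟨⟨(j : ℕ) - (n - s - 1), by have := j.2; omega⟩, ?_⟩
      ext
      simp
      omega
  · have h : Algebra.IsIntegral (Polynomial K) (MvPolynomial (Fin (s + 1)) K ⧸ L) := inferInstance
    have h' := algebraMap_isIntegral_iff.2 h
    rwa [show algebraMap (Polynomial K) (MvPolynomial (Fin (s + 1)) K ⧸ L) = γ.toRingHom from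
      RingHom.ext hγ] at h'
end
end

section
/- Let K be a perfect field, V ⊆ K̄^n an equidimensional K-variety of dimension n − s with I(V) = (F_1, ..., F_s), Y_1, ..., Y_n ∈ K[X_1, ..., X_n] linearly independent linear forms such that π : V → K̄^{n−s} defined by Y_1, ..., Y_{n−s} is a finite morphism, R := K[Y_1, ..., Y_{n−s}], K[V] a free R-module of finite rank, and p = (p_1, ..., p_{n−s}) ∈ K^{n−s} a lifting point of π. For 1 ≤ i ≤ s, let G_i ∈ K[Y_{n−s+1}, ..., Y_n] be obtained from F_i by rewriting F_i in the coordinates Y_1, ..., Y_n and substituting p_k for Y_k for 1 ≤ k ≤ n − s. Then the Jacobian determinant of G_1, ..., G_s with respect to Y_{n−s+1}, ..., Y_n is a unit in the quotient ring K[Y_{n−s+1}, ..., Y_n]/(G_1, ..., G_s). -/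
open MvPolynomial

noncomputable section

open scoped Matrix

namespace MvPolynomial

/-- The chain rule for partial derivatives of a composition of polynomials. -/
theorem pderiv_aeval {R σ τ : Type*} [CommRing R] [Fintype σ] (g : σ → MvPolynomial τ R)
    (j : τ) (f : MvPolynomial σ R) :
    pderiv j (aeval g f) = ∑ k, aeval g (pderiv k f) * pderiv j (g k) := by
  classical
  induction f using MvPolynomial.induction_on with
  | C a => simp
  | add p q hp hq => simp only [map_add, hp, hq, add_mul, Finset.sum_add_distrib]
  | mul_X p i hp =>
    simp only [map_mul, aeval_X, pderiv_mul, hp, map_add, add_mul, Finset.sum_add_distrib,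
      Finset.sum_mul, pderiv_X, Pi.single_apply, apply_ite (aeval g), map_zero,
      mul_ite, mul_one, mul_zero, ite_mul, zero_mul, Finset.sum_ite_eq, Finset.mem_univ, if_true]
    congr 1
    exact Finset.sum_congr rfl fun k _ => by ring

theorem IsHomogeneous.pderiv_eq_C {R σ : Type*} [CommRing R] {f : MvPolynomial σ R}
    (hf : f.IsHomogeneous 1) (j : σ) : pderiv j f = C (coeff 0 (pderiv j f)) :=
  totalDegree_eq_zero_iff_eq_C.1 (Nat.le_zero.1 (hf.pderiv (i := j)).totalDegree_le)

theorem IsHomogeneous.eq_sum_C_mul_X {R σ : Type*} [CommRing R] [Fintype σ]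
    {f : MvPolynomial σ R} (hf : f.IsHomogeneous 1) :
    f = ∑ j, C (coeff 0 (pderiv j f)) * X j := by
  conv_lhs => rw [← one_smul ℕ f, ← hf.sum_X_mul_pderiv]
  exact Finset.sum_congr rfl fun j _ => by rw [← hf.pderiv_eq_C, mul_comm]

/-- The coefficient matrix of linearly independent linear forms is invertible. -/
theorem det_coeff_pderiv_ne_zero {K σ : Type*} [Field K] [Fintype σ] [DecidableEq σ]
    {Y : σ → MvPolynomial σ K} (hY : ∀ i, (Y i).IsHomogeneous 1) (hind : LinearIndependent K Y) :
    (Matrix.of fun i j => coeff 0 (pderiv j (Y i))).det ≠ 0 := by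
  intro h
  obtain ⟨v, hv, hv0⟩ := Matrix.exists_vecMul_eq_zero_iff.2 h
  refine hv (_root_.funext (Fintype.linearIndependent_iff.1 hind v ?_))
  calc ∑ i, v i • Y i = ∑ i, v i • ∑ j, C (coeff 0 (pderiv j (Y i))) * X j :=
        Finset.sum_congr rfl fun i _ => by rw [← (hY i).eq_sum_C_mul_X]
    _ = ∑ j, C (∑ i, v i * coeff 0 (pderiv j (Y i))) * X j := by
        simp only [Finset.smul_sum, map_sum, Finset.sum_mul]
        rw [Finset.sum_comm]
        simp only [smul_eq_C_mul, map_mul, mul_assoc]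
    _ = 0 := Finset.sum_eq_zero fun j _ => by
        have : ∑ i, v i * coeff 0 (pderiv j (Y i)) = 0 := congrFun hv0 j
        rw [this, map_zero, zero_mul]

/-- A polynomial that is not invertible modulo `I` has a zero on the zero locus of `I`. -/
theorem exists_aeval_eq_zero_of_not_isUnit {k σ : Type*} (K : Type*) [Field k] [Field K]
    [Algebra k K] [IsAlgClosed K] [Finite σ] {I : Ideal (MvPolynomial σ k)} {f : MvPolynomial σ k}
    (hf : ¬ IsUnit (Ideal.Quotient.mk I f)) :
    ∃ y : σ → K, y ∈ zeroLocus K I ∧ aeval y f = 0 := by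
  obtain ⟨M, hM, hfM⟩ := exists_max_ideal_of_mem_nonunits hf
  have := Ideal.comap_isMaximal_of_surjective (Ideal.Quotient.mk I)
    Ideal.Quotient.mk_surjective (K := M)
  obtain ⟨y, hy⟩ := eq_vanishingIdeal_singleton_of_isMaximal K this
  have key : ∀ g, Ideal.Quotient.mk I g ∈ M → aeval y g = 0 := fun g hg =>
    (mem_vanishingIdeal_singleton_iff y g).1 (hy ▸ Ideal.mem_comap.2 hg)
  refine ⟨y, fun g hg => key g ?_, key f hfM⟩
  rw [Ideal.Quotient.eq_zero_iff_mem.2 hg]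
  exact M.zero_mem

end MvPolynomial

/-- Lemma 4.4 of the paper. -/
theorem stmt_8 {K : Type*} [Field K] [PerfectField K] (n s D : ℕ) (hsn : s ≤ n)
    (V : Set (Fin n → AlgebraicClosure K))
    (F : Fin s → MvPolynomial (Fin n) K)
    (hV : V = mvZeroSet (Set.range F))
    (hIV : mvVanishingIdeal V = Ideal.span (Set.range F))
    (hequi : ∀ P ∈ (mvVanishingIdeal V).minimalPrimes,
      ringKrullDim (MvPolynomial (Fin n) K ⧸ P) = ((n - s : ℕ) : WithBot ℕ∞))
    (Y : Fin n → MvPolynomial (Fin n) K)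
    (hYhom : ∀ i, (Y i).IsHomogeneous 1)
    (hYind : LinearIndependent K Y)
    -- `π : V → K̄^{n−s}` defined by `Y₁, …, Y_{n−s}` is a finite morphism
    (hfin : Function.Injective (coordMap (mvVanishingIdeal V)
        (fun i : Fin (n - s) => Y ⟨(i : ℕ), by have := i.2; omega⟩)) ∧
      RingHom.IsIntegral (coordMap (mvVanishingIdeal V)
        (fun i : Fin (n - s) => Y ⟨(i : ℕ), by have := i.2; omega⟩)).toRingHom)
    -- `K[V]` is a free `R`-module of finite rank `D`
    (hfree : ∃ g : Fin D → MvPolynomial (Fin n) K ⧸ mvVanishingIdeal V,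
      IsFreeBasisOver (mvVanishingIdeal V)
        (fun i : Fin (n - s) => Y ⟨(i : ℕ), by have := i.2; omega⟩) g)
    -- `p` is a lifting point of `π`
    (p : Fin (n - s) → K)
    (hp : IsLiftingPoint n s hsn V
      (fun i : Fin (n - s) => Y ⟨(i : ℕ), by have := i.2; omega⟩) F p)
    -- `Ft i` is `F i` rewritten in the coordinates `Y₁, …, Yₙ`
    (Ft : Fin s → MvPolynomial (Fin n) K)
    (hFt : ∀ i, MvPolynomial.aeval Y (Ft i) = F i) :
    -- the Jacobian determinant of `G₁, …, G_s` with respect to `Y_{n−s+1}, …, Yₙ` is a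
    -- unit in `K[Y_{n−s+1}, …, Yₙ]/(G₁, …, G_s)`, where `G i = F i (p, Y_{n−s+1}, …, Yₙ)`
    let G : Fin s → MvPolynomial (Fin s) K := fun i => substFirst n s hsn p (Ft i);
    IsUnit (Ideal.Quotient.mk (Ideal.span (Set.range G))
      (Matrix.det (Matrix.of fun i j : Fin s => MvPolynomial.pderiv j (G i)))) := by
  intro G
  by_contra hunit
  obtain ⟨y, hyG, hydet⟩ := exists_aeval_eq_zero_of_not_isUnit (AlgebraicClosure K) hunit
  set A : Matrix (Fin n) (Fin n) K := Matrix.of fun i j => coeff 0 (pderiv j (Y i)) with hA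
  set B := A.map (algebraMap K (AlgebraicClosure K)) with hB
  have hBdet : IsUnit B.det := by
    rw [hB, ← RingHom.mapMatrix_apply, ← RingHom.map_det, isUnit_iff_ne_zero]
    simpa using det_coeff_pderiv_ne_zero hYhom hYind
  set q : Fin n → MvPolynomial (Fin s) K := fun j =>
    if h : (j : ℕ) < n - s then MvPolynomial.C (p ⟨(j : ℕ), h⟩)
    else MvPolynomial.X ⟨(j : ℕ) - (n - s), by have := j.2; omega⟩ with hq
  have hGq : ∀ i, G i = aeval q (Ft i) := fun i => rfl
  -- The point `x` of the fiber of `p` whose last coordinates in the system `Y` are `y`.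
  set z : Fin n → AlgebraicClosure K := fun j => aeval y (q j) with hz
  have haevalz : ∀ f, aeval y (aeval q f) = aeval z f := fun f => by
    rw [← AlgHom.comp_apply, comp_aeval]
  have hYB : ∀ x i, aeval x (Y i) = (B *ᵥ x) i := fun x i => by
    conv_lhs => rw [(hYhom i).eq_sum_C_mul_X]
    simp [hB, hA, Matrix.mulVec, dotProduct]
  set x := B⁻¹ *ᵥ z with hx
  have hYx : ∀ i, aeval x (Y i) = z i := fun i => by
    rw [hYB, hx, Matrix.mulVec_mulVec, Matrix.mul_nonsing_inv _ hBdet, Matrix.one_mulVec]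
  have haevalx : ∀ f, aeval x (aeval Y f) = aeval z f := fun f => by
    rw [← AlgHom.comp_apply, comp_aeval]
    simp only [hYx]
  have hxV : x ∈ V := by
    rw [hV]
    rintro _ ⟨i, rfl⟩
    rw [← hFt, haevalx, ← haevalz, ← hGq]
    exact hyG _ (Ideal.subset_span ⟨i, rfl⟩)
  refine hp x ⟨hxV, fun i => ?_⟩ ?_
  · simp [hYx, hz, hq]
  -- A kernel vector of the Jacobian matrix of `G` at `y` extends by zero to one for `F` at `x`.
  rw [AlgHom.map_det] at hydet ⊢
  obtain ⟨v, hv, hv0⟩ := Matrix.exists_mulVec_eq_zero_iff.2 hydet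
  set w : Fin n → AlgebraicClosure K := fun k => ∑ j, aeval y (pderiv j (q k)) * v j with hw
  have hwlast : ∀ j : Fin s, w ⟨n - s + j, by omega⟩ = v j := fun j => by
    simp [hw, hq, pderiv_X, Pi.single_apply, apply_ite (aeval y)]
  have hwfirst : ∀ k : Fin n, (k : ℕ) < n - s → w k = 0 := fun k hk => by
    simp [hw, hq, hk]
  obtain ⟨u, hBu⟩ : ∃ u : Fin n → AlgebraicClosure K,
      ∀ k, ∑ j, aeval x (pderiv j (Y k)) * u j = w k := ⟨B⁻¹ *ᵥ w, fun k => by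
    calc _ = (B *ᵥ (B⁻¹ *ᵥ w)) k := Finset.sum_congr rfl fun j _ => by
          rw [(hYhom k).pderiv_eq_C]
          simp [hB, hA]
      _ = w k := by rw [Matrix.mulVec_mulVec, Matrix.mul_nonsing_inv _ hBdet, Matrix.one_mulVec]⟩
  refine Matrix.exists_mulVec_eq_zero_iff.1 ⟨u, fun h0 => hv (_root_.funext fun j => ?_), ?_⟩
  · rw [← hwlast, ← hBu, h0]
    simp
  ext i
  by_cases hi : (i : ℕ) < n - s
  · simpa [Matrix.mulVec, dotProduct, jacMat, hi, hwfirst i hi] using hBu i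
  · have hG0 := congrFun hv0 ⟨(i : ℕ) - (n - s), by omega⟩
    simp only [Matrix.mulVec, dotProduct, AlgHom.mapMatrix_apply, Matrix.map_apply,
      Matrix.of_apply, Pi.zero_apply, hGq, jacMat, hi, dite_false, ← hFt, pderiv_aeval,
      map_sum, map_mul, haevalz, haevalx, Finset.sum_mul] at hG0 ⊢
    rw [Finset.sum_comm] at hG0 ⊢
    simp only [mul_assoc, ← Finset.mul_sum] at hG0 ⊢
    simpa only [hBu, hw] using hG0
end
end
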